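/- arXiv:math/0611673 — 2 statements merged into one kernel-verified Lean document; each statement's English description precedes it below -/
import Mathlib

section
/- (a) Let K be a field containing the field F₄ with four elements (so char K = 2 and K contains a primitive cube root of unity). Then ed_K(A_{n+3}) ≥ ed_K(A_n) + 1 for every integer n ≥ 3 with n ≠ 4. (b) For any field K of characteristic 2, ed_K(A_n) ≥ ⌊n/3⌋ for every integer n ≥ 3. -/
noncomputable section

/-- The transcendence degree of `L` over `K`: the supremum of the cardinalities of
algebraically independent subsets of `L`. -/
noncomputable def trdeg (K L : Type*) [CommRing K] [CommRing L] [Algebra K L] : Cardinal :=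
  ⨆ s : {s : Set L // AlgebraicIndependent K ((↑) : s → L)}, Cardinal.mk s.1

/-- The rational function field over `K` on variables indexed by `σ` :
the fraction field of the polynomial ring `K[x_i : i ∈ σ]`. -/
abbrev FnField (K : Type*) [Field K] (σ : Type*) : Type _ :=
  FractionRing (MvPolynomial σ K)

/-- Permutations of the variables acting on the polynomial ring by `K`-algebra
automorphisms. -/
noncomputable def permHom (K : Type*) [Field K] (σ : Type*) :
    Equiv.Perm σ →* (MvPolynomial σ K ≃ₐ[K] MvPolynomial σ K) where
  toFun e := MvPolynomial.renameEquiv K e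
  map_one' := MvPolynomial.renameEquiv_refl K
  map_mul' e f := by
    ext x
    simp [MvPolynomial.renameEquiv, Equiv.Perm.mul_apply]

/-- Permutations of the variables acting on the rational function field by
`K`-algebra automorphisms. -/
noncomputable def permGalAction (K : Type*) [Field K] (σ : Type*) :
    Equiv.Perm σ →* (FnField K σ ≃ₐ[K] FnField K σ) :=
  (IsFractionRing.fieldEquivOfAlgEquivHom K (FnField K σ)).comp (permHom K σ)

/-- The action of a group `G` on its rational function field `K(x_g : g ∈ G)` by
`K`-algebra automorphisms, permuting the variables by left translation:
`σ • x_g = x_{σg}`. -/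
noncomputable def galAction (K : Type*) [Field K] (G : Type*) [Group G] :
    G →* (FnField K G ≃ₐ[K] FnField K G) :=
  (permGalAction K G).comp (MulAction.toPermHom G G)

/-- The essential dimension of a group `G` over the field `K`:
the minimum of the transcendence degrees over `K` of the `G`-stable intermediate
subfields of the rational function field `K(x_g : g ∈ G)` on which `G` acts
faithfully. -/
noncomputable def edK (K : Type*) [Field K] (G : Type*) [Group G] : ℕ :=
  sInf { d : ℕ | ∃ E : IntermediateField K (FnField K G),
    (∀ g : G, ∀ x ∈ E, galAction K G g x ∈ E) ∧
    (∀ g : G, g ≠ 1 → ∃ x ∈ E, galAction K G g x ≠ x) ∧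
    trdeg K E = d }

universe u

open Cardinal in
theorem exists_algebraicIndependent_subset_mk_eq_trdeg_adjoin {k M : Type u} [Field k] [Field M]
    [Algebra k M] (S : Set M) :
    ∃ t ⊆ S, AlgebraicIndependent k ((↑) : t → M) ∧
      #t = Algebra.trdeg k (IntermediateField.adjoin k S) := by
  open scoped IntermediateField.algebraAdjoinAdjoin in
  set A := Algebra.adjoin k S with hA
  let s : Set A := Subtype.val ⁻¹' S
  have hs : Algebra.adjoin k s = ⊤ := Algebra.adjoin_adjoin_coe_preimage
  have : Algebra.IsAlgebraic (Algebra.adjoin k s) A := by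
    refine ⟨fun x ↦ isAlgebraic_algebraMap (⟨x, hs ▸ Algebra.mem_top⟩ : Algebra.adjoin k s)⟩
  obtain ⟨t, hts, ht⟩ := exists_isTranscendenceBasis_subset (R := k) s
  refine ⟨Subtype.val '' t, Set.image_subset_iff.2 hts, ?_, ?_⟩
  · exact (ht.1.map' (f := A.val) Subtype.val_injective).image
  · rw [Cardinal.mk_image_eq Subtype.val_injective, ht.cardinalMk_eq_trdeg]
    have : Algebra.IsAlgebraic A (IntermediateField.adjoin k S) :=
      IsLocalization.isAlgebraic _ (nonZeroDivisors A)
    have h := trdeg_add_eq k A (A := IntermediateField.adjoin k S)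
    rwa [trdeg_eq_zero (R := A), add_zero] at h

section Place
variable {K k O M M' : Type u} [Field K] [Field k] [CommRing O] [Algebra K O]
  [Field M] [Algebra K M] [Field M'] [Algebra K M'] [Algebra k M']

/-- The subfield of `M'` generated over `k` by the specializations along `φ` of those elements of
`O` which lie in `E`. -/
def IntermediateField.specialize (ι : O →ₐ[K] M) (φ : O →ₐ[K] M') (k : Type u) [Field k]
    [Algebra k M'] (E : IntermediateField K M) : IntermediateField k M' :=
  IntermediateField.adjoin k (φ '' (ι ⁻¹' E))

variable {ι : O →ₐ[K] M} {φ : O →ₐ[K] M'}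

theorem IntermediateField.mem_specialize {E : IntermediateField K M} {y : O} (hy : ι y ∈ E) :
    φ y ∈ IntermediateField.specialize ι φ k E :=
  IntermediateField.subset_adjoin _ _ ⟨y, hy, rfl⟩

variable [Algebra K k] [IsScalarTower K k M']

theorem IntermediateField.exists_lift_trdeg_specialize (E : IntermediateField K M) :
    ∃ (t : Type u) (x : t → O), (∀ i, ι (x i) ∈ E) ∧ AlgebraicIndependent K (φ ∘ x) ∧
      Cardinal.mk t = Algebra.trdeg k (IntermediateField.specialize ι φ k E) := by
  obtain ⟨t, hts, ht, hcard⟩ :=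
    exists_algebraicIndependent_subset_mk_eq_trdeg_adjoin (k := k) (φ '' (ι ⁻¹' E))
  choose x hx hx' using fun i : t ↦ hts i.2
  refine ⟨t, x, hx, ?_, hcard⟩
  convert! ht.restrictScalars (algebraMap K k).injective using 1
  exact funext hx'

theorem IntermediateField.trdeg_specialize_le (hι : Function.Injective ι)
    (E : IntermediateField K M) :
    Algebra.trdeg k (IntermediateField.specialize ι φ k E) ≤ Algebra.trdeg K E := by
  obtain ⟨t, x, hx, hind, hcard⟩ :=
    IntermediateField.exists_lift_trdeg_specialize (k := k) (ι := ι) (φ := φ) E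
  rw [← hcard]
  have h1 : AlgebraicIndependent K (ι ∘ x) := (hind.of_comp φ).map' hι
  exact AlgebraicIndependent.cardinalMk_le_trdeg (x := fun i ↦ (⟨ι (x i), hx i⟩ : E))
    (AlgebraicIndependent.of_comp E.val h1)

theorem AlgebraicIndependent.transcendental_of_map_eq_zero [IsDomain O] {t : Type u} {x : t → O}
    (hind : AlgebraicIndependent K (φ ∘ x)) {ϖ : O} (h0 : ϖ ≠ 0) (hϖ : φ ϖ = 0) :
    Transcendental (Algebra.adjoin K (Set.range x)) ϖ := by
  have hinj : ∀ a ∈ Algebra.adjoin K (Set.range x), φ a = 0 → a = 0 := by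
    intro a ha h
    rw [Algebra.adjoin_range_eq_range_aeval] at ha
    obtain ⟨p, rfl⟩ := ha
    have : MvPolynomial.aeval (φ ∘ x) p = 0 := by
      rw [← h]
      exact (MvPolynomial.comp_aeval_apply x φ p).symm
    rw [algebraicIndependent_iff.1 hind p this]
    exact map_zero _
  rw [transcendental_iff]
  intro p hp
  by_contra hne
  obtain ⟨q, hq, hq0⟩ := Polynomial.exists_eq_pow_rootMultiplicity_mul_and_not_dvd p hne 0
  rw [Polynomial.C_0, sub_zero] at hq hq0
  rw [hq, map_mul, map_pow, Polynomial.aeval_X] at hp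
  have hq' := (mul_eq_zero.1 hp).resolve_left (pow_ne_zero _ h0)
  rw [Polynomial.X_dvd_iff] at hq0
  apply hq0
  apply Subtype.ext
  apply hinj _ (Subtype.property _)
  rw [← Polynomial.divX_mul_X_add q] at hq'
  simp only [map_add, map_mul, Polynomial.aeval_X, Polynomial.aeval_C] at hq'
  have := congrArg φ hq'
  simpa [hϖ] using this

theorem IntermediateField.trdeg_specialize_add_one_le (hι : Function.Injective ι)
    (E : IntermediateField K M) {ϖ : O} (hE : ι ϖ ∈ E) (h0 : ϖ ≠ 0) (hϖ : φ ϖ = 0) :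
    Algebra.trdeg k (IntermediateField.specialize ι φ k E) + 1 ≤ Algebra.trdeg K E := by
  obtain ⟨t, x, hx, hind, hcard⟩ :=
    IntermediateField.exists_lift_trdeg_specialize (k := k) (ι := ι) (φ := φ) E
  have : IsDomain O := hι.isDomain ι.toRingHom
  have h1 := (((hind.of_comp φ).option_iff_transcendental ϖ).2
    (hind.transcendental_of_map_eq_zero h0 hϖ)).map' hι
  have hmem : ∀ o : Option t, ι (o.elim ϖ x) ∈ E := by
    rintro (_ | i)
    exacts [hE, hx i]
  rw [← hcard, ← Cardinal.mk_option]
  exact AlgebraicIndependent.cardinalMk_le_trdeg (x := fun o ↦ (⟨_, hmem o⟩ : E))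
    (AlgebraicIndependent.of_comp E.val h1)

end Place

section Compression
variable {H : Type} [Group H]

/-- `d` bounds the transcendence degree of some faithful `H`-subfield of `M`. -/
def HasCompression {K M : Type u} [Field K] [Field M] [Algebra K M] (ρ : H →* (M →ₐ[K] M))
    (d : ℕ) : Prop :=
  ∃ E : IntermediateField K M, (∀ h, ∀ x ∈ E, ρ h x ∈ E) ∧ (∀ h, h ≠ 1 → ∃ x ∈ E, ρ h x ≠ x) ∧
    Algebra.trdeg K E ≤ d

theorem IntermediateField.map_mem_specialize {K k O M M' : Type u} [Field K] [Field k]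
    [CommRing O] [Algebra K O] [Field M] [Algebra K M] [Field M'] [Algebra K M'] [Algebra k M']
    {ι : O →ₐ[K] M} {φ : O →ₐ[K] M'} {σ : M →ₐ[K] M} {τ : M' →ₐ[k] M'}
    (hστ : ∀ y, ∃ y', ι y' = σ (ι y) ∧ φ y' = τ (φ y)) {E : IntermediateField K M}
    (hE : ∀ x ∈ E, σ x ∈ E) {x : M'} (hx : x ∈ IntermediateField.specialize ι φ k E) :
    τ x ∈ IntermediateField.specialize ι φ k E := by
  suffices h : IntermediateField.specialize ι φ k E ≤
    (IntermediateField.specialize ι φ k E).comap τ from h hx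
  refine IntermediateField.adjoin_le_iff.2 ?_
  rintro _ ⟨y, hy, rfl⟩
  obtain ⟨y', h1, h2⟩ := hστ y
  change τ (φ y) ∈ IntermediateField.specialize ι φ k E
  rw [← h2]
  exact IntermediateField.mem_specialize (h1 ▸ hE _ hy)

/-- The action on the rational function field induced by permutations of the variables. -/
def permAlgHom (K : Type*) [Field K] {X : Type*} (θ : H →* Equiv.Perm X) :
    H →* (FnField K X →ₐ[K] FnField K X) where
  toFun h := (permGalAction K X (θ h) : FnField K X →ₐ[K] FnField K X)
  map_one' := by ext; simp
  map_mul' a b := by ext; simp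

theorem permAlgHom_algebraMap (K : Type*) [Field K] {X : Type*} (θ : H →* Equiv.Perm X) (h : H)
    (p : MvPolynomial X K) :
    permAlgHom K θ h (algebraMap _ _ p) = algebraMap _ (FnField K X)
      (MvPolynomial.rename (θ h) p) := by
  simp [permAlgHom, permGalAction, permHom]

open MvPolynomial

theorem MvPolynomial.exists_localization_specialization {K M' : Type u} {X : Type} [Field K]
    [Field M'] [Algebra K M'] (v : X → M') :
    ∃ (O : Type u) (_ : CommRing O) (_ : Algebra K O) (ι : O →ₐ[K] FnField K X) (φ : O →ₐ[K] M'),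
      Function.Injective ι ∧
      (∀ y, ∃ a q : MvPolynomial X K, aeval v q ≠ 0 ∧
        ι y * algebraMap _ _ q = algebraMap _ _ a ∧ φ y * aeval v q = aeval v a) ∧
      ∀ a q : MvPolynomial X K, aeval v q ≠ 0 → ∃ y,
        ι y * algebraMap _ _ q = algebraMap _ _ a ∧ φ y * aeval v q = aeval v a := by
  let S : Submonoid (MvPolynomial X K) :=
    (nonZeroDivisors M').comap (aeval v : MvPolynomial X K →ₐ[K] M')
  have hS : ∀ q : S, aeval v (q : MvPolynomial X K) ≠ 0 := fun q ↦
    nonZeroDivisors.ne_zero q.2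
  have hS0 : ∀ q : S, (q : MvPolynomial X K) ≠ 0 := fun q h ↦ hS q (by rw [h, map_zero])
  have hι : ∀ q : S, IsUnit (IsScalarTower.toAlgHom K (MvPolynomial X K) (FnField K X) q) :=
    fun q ↦ (IsUnit.mk0 _ ((FaithfulSMul.algebraMap_injective _ (FnField K X)).ne_iff' (map_zero _)
      |>.2 (hS0 q)))
  have hφ : ∀ q : S, IsUnit (aeval v (q : MvPolynomial X K)) := fun q ↦ IsUnit.mk0 _ (hS q)
  refine ⟨Localization S, inferInstance, inferInstance,
    IsLocalization.liftAlgHom (M := S) hι, IsLocalization.liftAlgHom (M := S) hφ, ?_, ?_, ?_⟩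
  · rw [IsLocalization.coe_liftAlgHom, IsLocalization.lift_injective_iff]
    intro x y
    rw [(IsLocalization.injective _ (fun q hq ↦ mem_nonZeroDivisors_of_ne_zero
      (hS0 ⟨q, hq⟩) : S ≤ nonZeroDivisors _)).eq_iff]
    exact (FaithfulSMul.algebraMap_injective _ (FnField K X)).eq_iff.symm
  · intro y
    obtain ⟨⟨a, q⟩, h⟩ := IsLocalization.surj S y
    refine ⟨a, q, hS q, ?_, ?_⟩
    · simpa using congrArg (IsLocalization.lift hι) h
    · simpa using congrArg (IsLocalization.lift hφ) h
  · intro a q hq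
    let q' : S := ⟨q, mem_nonZeroDivisors_of_ne_zero hq⟩
    have h := IsLocalization.mk'_spec (Localization S) a q'
    refine ⟨IsLocalization.mk' (Localization S) a q', ?_, ?_⟩
    · rw [IsLocalization.coe_liftAlgHom]
      refine .trans ?_ ((congrArg (IsLocalization.lift hι) h).trans (IsLocalization.lift_eq hι a))
      rw [map_mul, IsLocalization.lift_eq]
      rfl
    · rw [IsLocalization.coe_liftAlgHom]
      refine .trans ?_ ((congrArg (IsLocalization.lift hφ) h).trans (IsLocalization.lift_eq hφ a))
      rw [map_mul, IsLocalization.lift_eq]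
      rfl

theorem HasCompression.of_specialization [Finite H] {K k M' : Type u} {X : Type} [Field K]
    [Field k] [Algebra K k] [Field M'] [Algebra K M'] [Algebra k M'] [IsScalarTower K k M']
    {θ : H →* Equiv.Perm X} {ρ : H →* (M' →ₐ[k] M')}
    (hv : ∀ Q : MvPolynomial X K, Q ≠ 0 →
      ∃ v : X → M', (∀ h x, v (θ h x) = ρ h (v x)) ∧ aeval v Q ≠ 0)
    {d : ℕ} (hd : HasCompression (permAlgHom K θ) d) : HasCompression ρ d := by
  have := Fintype.ofFinite H
  classical
  obtain ⟨E, hE, hfaith, hdeg⟩ := hd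
  have hfrac : ∀ h : H, ∃ a q : MvPolynomial X K, q ≠ 0 ∧ (h ≠ 1 →
      rename (θ h) a * q - a * rename (θ h) q ≠ 0 ∧
      algebraMap _ (FnField K X) a / algebraMap _ _ q ∈ E) := by
    intro h
    by_cases h1 : h = 1
    · exact ⟨0, 1, one_ne_zero, fun h ↦ absurd h1 h⟩
    obtain ⟨f, hf, hne⟩ := hfaith h h1
    obtain ⟨a, q, hq, rfl⟩ := IsFractionRing.div_surjective (A := MvPolynomial X K) f
    have hq0 := nonZeroDivisors.ne_zero hq
    refine ⟨a, q, hq0, fun _ ↦ ⟨fun h0 ↦ hne ?_, hf⟩⟩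
    rw [map_div₀, permAlgHom_algebraMap, permAlgHom_algebraMap, div_eq_div_iff, ← map_mul,
      ← map_mul, sub_eq_zero.1 h0]
    · simpa using (rename_injective _ (θ h).injective).ne_iff' (map_zero _) |>.2 hq0
    · simpa using hq0
  choose a q hq haq using hfrac
  obtain ⟨v, hv, hQ⟩ := hv (∏ h : H, q h * if h = 1 then 1 else
    rename (θ h) (a h) * q h - a h * rename (θ h) (q h)) (Finset.prod_ne_zero_iff.2 fun h _ ↦ by
      split_ifs with h1
      exacts [mul_ne_zero (hq h) one_ne_zero, mul_ne_zero (hq h) (haq h h1).1])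
  have hvr : ∀ h (p : MvPolynomial X K), aeval v (rename (θ h) p) = ρ h (aeval v p) := by
    intro h p
    rw [aeval_rename]
    have : v ∘ θ h = fun x ↦ ρ h (v x) := funext (hv h)
    rw [this]
    exact (comp_aeval_apply v ((ρ h).restrictScalars K) p).symm
  obtain ⟨O, _, _, ι, φ, hι, hO, hO'⟩ := exists_localization_specialization (K := K) v
  refine ⟨IntermediateField.specialize ι φ k E, fun h x hx ↦
    IntermediateField.map_mem_specialize (fun y ↦ ?_) (hE h) hx, fun h h1 ↦ ?_,
    (IntermediateField.trdeg_specialize_le hι E).trans hdeg⟩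
  · obtain ⟨a, q, hq, h1, h2⟩ := hO y
    have hq' : ρ h (aeval v q) ≠ 0 := by simpa using hq
    obtain ⟨y', h3, h4⟩ := hO' (rename (θ h) a) (rename (θ h) q) (by rwa [hvr])
    refine ⟨y', ?_, ?_⟩
    · have hq0 : algebraMap _ (FnField K X) q ≠ 0 := by
        intro h0
        rw [FaithfulSMul.algebraMap_eq_zero_iff] at h0
        exact hq (by rw [h0, map_zero])
      have : permAlgHom K θ h (algebraMap _ _ q) ≠ 0 := by simpa using hq0
      apply mul_right_cancel₀ this
      rw [← map_mul, h1, permAlgHom_algebraMap, permAlgHom_algebraMap, h3]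
    · apply mul_right_cancel₀ hq'
      rw [← map_mul, h2, ← hvr, ← hvr, h4]
  · rw [map_prod, Finset.prod_ne_zero_iff] at hQ
    have hQh := hQ h (Finset.mem_univ h)
    rw [if_neg h1, map_mul, mul_ne_zero_iff, map_sub, map_mul, map_mul, hvr, hvr] at hQh
    obtain ⟨y, h2, h3⟩ := hO' (a h) (q h) hQh.1
    refine ⟨φ y, IntermediateField.mem_specialize ?_, fun h4 ↦ hQh.2 ?_⟩
    · rw [eq_div_of_mul_eq ?_ h2]
      · exact (haq h h1).2
      · simpa using hq h
    · rw [← h3, map_mul, h4]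
      ring

theorem HasCompression.baseChange [Finite H] {K k : Type u} {X : Type} [Field K]
    [Field k] [Algebra K k] {θ : H →* Equiv.Perm X} {d : ℕ}
    (hd : HasCompression (permAlgHom K θ) d) : HasCompression (permAlgHom k θ) d := by
  refine hd.of_specialization fun Q hQ ↦
    ⟨fun x ↦ algebraMap (MvPolynomial X k) (FnField k X) (MvPolynomial.X x),
    fun h x ↦ by rw [permAlgHom_algebraMap, rename_X], ?_⟩
  have h1 : aeval (R := K) (MvPolynomial.X (R := k)) Q = map (algebraMap K k) Q := by
    rw [aeval_def, IsScalarTower.algebraMap_eq K k, algebraMap_eq, ← eval₂_map,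
      eval₂_eta]
  have h2 := (FaithfulSMul.algebraMap_injective _ (FnField k X)).ne_iff' (map_zero _) |>.2
    ((map_injective (σ := X) _ (algebraMap K k).injective).ne_iff' (map_zero _) |>.2 hQ)
  rw [← h1, ← IsScalarTower.coe_toAlgHom' K] at h2
  exact fun h ↦ h2 ((comp_aeval_apply _ _ Q).trans h)

theorem MvPolynomial.exists_aeval_X_pow_ne_zero {K σ : Type*} [CommRing K] [Finite σ] {n : ℕ}
    {Q : MvPolynomial (σ × Fin n) K} (hQ : Q ≠ 0) :
    ∃ N : ℕ, aeval (fun p : σ × Fin n ↦ (X p.1 ^ N ^ (p.2 : ℕ) : MvPolynomial σ K)) Q ≠ 0 := by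
  have := Fintype.ofFinite σ
  classical
  let N := Q.totalDegree + 1
  let f : (σ × Fin n →₀ ℕ) → (σ →₀ ℕ) := fun s ↦
    Finsupp.equivFunOnFinite.symm fun h ↦ ∑ i : Fin n, s (h, i) * N ^ (i : ℕ)
  have hf : Set.InjOn f Q.support := by
    intro s hs t ht hst
    have hlt : ∀ s ∈ Q.support, ∀ p, s p < N := fun s hs p ↦ Nat.lt_succ_of_le <|
      (Finsupp.le_degree p s).trans (le_totalDegree hs)
    ext ⟨h, i⟩
    have h1 := DFunLike.congr_fun hst h
    have h2 : finFunctionFinEquiv (fun i ↦ (⟨s (h, i), hlt s hs _⟩ : Fin N)) =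
        finFunctionFinEquiv (fun i ↦ (⟨t (h, i), hlt t ht _⟩ : Fin N)) := by
      ext
      simpa [finFunctionFinEquiv_apply, f] using h1
    have h3 := congrFun (finFunctionFinEquiv.injective h2) i
    simpa using h3
  have hmon : ∀ s c, aeval (fun p : σ × Fin n ↦ (X p.1 ^ N ^ (p.2 : ℕ) : MvPolynomial σ K))
      (monomial s c) = monomial (f s) c := by
    intro s c
    rw [aeval_monomial, monomial_eq, Finsupp.prod_fintype _ _ (by simp),
      Finsupp.prod_fintype _ _ (by simp), Fintype.prod_prod_type]
    congr 1
    refine Finset.prod_congr rfl fun h _ ↦ ?_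
    simp only [← pow_mul, f, Finsupp.equivFunOnFinite_symm_apply_apply, Finset.prod_pow_eq_pow_sum]
    simp only [mul_comm]
  refine ⟨N, fun h0 ↦ ?_⟩
  obtain ⟨s, hs⟩ := support_nonempty.2 hQ
  refine mem_support_iff.1 hs ?_
  rw [Q.as_sum, map_sum, Finset.sum_congr rfl fun s _ ↦ hmon s _] at h0
  have := congrArg (coeff (f s)) h0
  rw [coeff_sum, Finset.sum_eq_single_of_mem s hs, coeff_monomial, if_pos rfl] at this
  · simpa using this
  · intro t ht hts
    rw [coeff_monomial, if_neg fun h ↦ hts (hf ht hs h)]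

/-- The regular representation receives every free permutation representation. -/
theorem HasCompression.to_regular [Finite H] {K : Type u} {X : Type} [Field K]
    {θ : H →* Equiv.Perm X} {n : ℕ} (η : X → H × Fin n) (hinj : Function.Injective η)
    (hη : ∀ h x, η (θ h x) = (h * (η x).1, (η x).2)) {d : ℕ}
    (hd : HasCompression (permAlgHom K θ) d) :
    HasCompression (permAlgHom K (MulAction.toPermHom H H)) d := by
  refine hd.of_specialization fun Q hQ ↦ ?_
  obtain ⟨N, hN⟩ := exists_aeval_X_pow_ne_zero
    ((rename_injective η hinj).ne_iff' (map_zero _) |>.2 hQ)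
  rw [aeval_rename, Function.comp_def] at hN
  refine ⟨fun x ↦ algebraMap (MvPolynomial H K) (FnField K H)
    (MvPolynomial.X (η x).1 ^ N ^ ((η x).2 : ℕ)), ?_, ?_⟩
  · intro h x
    rw [permAlgHom_algebraMap, map_pow, rename_X]
    simp only [hη]
    rfl
  · have := (FaithfulSMul.algebraMap_injective _ (FnField K H)).ne_iff' (map_zero _) |>.2 hN
    rw [← IsScalarTower.coe_toAlgHom' K] at this
    exact fun h ↦ this ((comp_aeval_apply _ _ Q).trans h)

theorem HasCompression.restrict {G : Type} [Group G] {K M : Type u} [Field K] [Field M]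
    [Algebra K M] {ρ : G →* (M →ₐ[K] M)} {d : ℕ} (hd : HasCompression ρ d) {f : H →* G}
    (hf : Function.Injective f) : HasCompression (ρ.comp f) d := by
  obtain ⟨E, hE, hfaith, hdeg⟩ := hd
  exact ⟨E, fun h ↦ hE (f h), fun h h1 ↦ hfaith (f h) ((map_ne_one_iff f hf).2 h1), hdeg⟩

theorem HasCompression.regular_of_injective {G : Type} [Group G] [Finite G] {K : Type u} [Field K]
    {f : H →* G} (hf : Function.Injective f) {d : ℕ}
    (hd : HasCompression (permAlgHom K (MulAction.toPermHom G G)) d) :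
    HasCompression (permAlgHom K (MulAction.toPermHom H H)) d := by
  have : Finite H := Finite.of_injective f hf
  let r : G → G := fun g ↦ (QuotientGroup.mk g⁻¹ : G ⧸ f.range).out
  have hr : ∀ g, ∃ h, f h = g * r g := by
    intro g
    have := QuotientGroup.mk_out_eq_mul f.range g⁻¹
    obtain ⟨⟨_, h, rfl⟩, hh⟩ := this
    exact ⟨h, by simp [r, hh]⟩
  choose η hη using hr
  have hrf : ∀ h g, r (f h * g) = r g := by
    intro h g
    have : (QuotientGroup.mk (f h * g)⁻¹ : G ⧸ f.range) = QuotientGroup.mk g⁻¹ := by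
      rw [QuotientGroup.eq]
      simp
    simp only [r, this]
  let e := Finite.equivFin G
  refine HasCompression.to_regular (θ := (MulAction.toPermHom G G).comp f)
    (fun g ↦ (η g, e (r g))) ?_ ?_ (hd.restrict hf)
  · intro g g' h
    simp only [Prod.mk.injEq, EmbeddingLike.apply_eq_iff_eq] at h
    have := hη g
    rw [h.1, hη, h.2] at this
    exact (mul_right_cancel this).symm
  · intro h g
    change (η (f h * g), e (r (f h * g))) = _
    rw [hrf]
    refine Prod.ext (hf ?_) rfl
    rw [hη, hrf, map_mul, hη, mul_assoc]

section EssentialDimension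
variable (K : Type u) [Field K] (G : Type) [Group G]

theorem hasCompression_edK [Finite G] :
    HasCompression (permAlgHom K (MulAction.toPermHom G G)) (edK K G) := by
  have hne : { d : ℕ | ∃ E : IntermediateField K (FnField K G),
      (∀ g : G, ∀ x ∈ E, galAction K G g x ∈ E) ∧
      (∀ g : G, g ≠ 1 → ∃ x ∈ E, galAction K G g x ≠ x) ∧ trdeg K E = d }.Nonempty := by
    refine ⟨Nat.card G, ⊤, fun _ _ _ ↦ trivial, fun g hg ↦
      ⟨algebraMap (MvPolynomial G K) _ (MvPolynomial.X 1), trivial, ?_⟩, ?_⟩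
    · change permAlgHom K (MulAction.toPermHom G G) g _ ≠ _
      rw [permAlgHom_algebraMap, (FaithfulSMul.algebraMap_injective _ (FnField K G)).ne_iff,
        rename_X, (X_injective).ne_iff]
      simpa using hg
    · change Algebra.trdeg K (⊤ : IntermediateField K (FnField K G)) = _
      have : Algebra.IsAlgebraic (MvPolynomial G K) (FnField K G) :=
        IsLocalization.isAlgebraic _ (nonZeroDivisors _)
      have h := trdeg_add_eq K (MvPolynomial G K) (A := FnField K G)
      rw [trdeg_eq_zero (R := MvPolynomial G K), add_zero, MvPolynomial.trdeg_of_isDomain] at h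
      rw [IntermediateField.topEquiv.trdeg_eq, ← h]
      have := Fintype.ofFinite G
      rw [Cardinal.mk_fintype, Cardinal.lift_natCast, Nat.card_eq_fintype_card]
  obtain ⟨E, hE, hfaith, hdeg⟩ := Nat.sInf_mem hne
  exact ⟨E, hE, hfaith, hdeg.le⟩

variable {K G}

theorem HasCompression.edK_le {d : ℕ}
    (hd : HasCompression (permAlgHom K (MulAction.toPermHom G G)) d) : edK K G ≤ d := by
  obtain ⟨E, hE, hfaith, hdeg⟩ := hd
  obtain ⟨n, hn⟩ := Cardinal.lt_aleph0.1 (hdeg.trans_lt Cardinal.natCast_lt_aleph0)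
  have : edK K G ≤ n := Nat.sInf_le ⟨E, hE, hfaith, hn⟩
  rw [hn, Nat.cast_le] at hdeg
  exact this.trans hdeg

end EssentialDimension

end Compression

section Laurent
open HahnSeries
variable {K F : Type u} [Field K] [Field F] [Algebra K F]

/-- The automorphism `∑ aₙ tⁿ ↦ ∑ uⁿ σ(aₙ) tⁿ` of the field of Laurent series. -/
def LaurentSeries.twist (σ : F →ₐ[K] F) (u : Kˣ) : LaurentSeries F →ₐ[K] LaurentSeries F where
  toFun f := ⟨fun n ↦ ((u ^ n : Kˣ) : K) • σ (f.coeff n), f.isPWO_support.mono fun n hn h ↦ hn <| by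
    simp [h]⟩
  map_one' := by
    ext n
    by_cases h : n = 0 <;> simp [coeff_one, h]
  map_zero' := by ext; simp
  map_add' x y := by ext; simp
  map_mul' x y := by
    ext n
    simp only [coeff_mul, map_sum, Finset.smul_sum]
    refine Finset.sum_congr ?_ ?_
    · ext
      simp [zpow_ne_zero]
    · intro ij hij
      rw [← (Finset.mem_antidiagonal.1 hij).2.2, zpow_add, map_mul, Units.val_mul,
        smul_mul_smul_comm]
  commutes' r := by
    ext n
    rw [algebraMap_apply', PowerSeries.algebraMap_apply, ofPowerSeries_C]
    by_cases h : n = 0 <;> simp [h]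

theorem LaurentSeries.coeff_twist (σ : F →ₐ[K] F) (u : Kˣ) (f : LaurentSeries F) (n : ℤ) :
    (twist σ u f).coeff n = ((u ^ n : Kˣ) : K) • σ (f.coeff n) := rfl

theorem LaurentSeries.order_twist (σ : F →ₐ[K] F) (u : Kˣ) (f : LaurentSeries F) :
    (twist σ u f).order = f.order := by
  by_cases hf : f = 0
  · simp [hf]
  refine le_antisymm (order_le_of_coeff_ne_zero ?_) (order_le_of_coeff_ne_zero fun h ↦ ?_)
  · simpa [coeff_twist, coeff_order_eq_zero] using ⟨zpow_ne_zero _ u.ne_zero, hf⟩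
  · have : twist σ u f ≠ 0 := by simpa using hf
    rw [← leadingCoeff_ne_zero, leadingCoeff_eq, coeff_twist, h] at this
    simp at this

theorem LaurentSeries.order_inv (f : LaurentSeries F) : f⁻¹.order = -f.order := by
  by_cases hf : f = 0
  · simp [hf]
  have := order_mul hf (inv_ne_zero hf)
  rw [mul_inv_cancel₀ hf, order_one] at this
  omega

theorem LaurentSeries.order_zpow (f : LaurentSeries F) (n : ℤ) : (f ^ n).order = n * f.order := by
  cases n with
  | ofNat n => simp
  | negSucc n => rw [zpow_negSucc, order_inv, order_pow, Int.negSucc_eq]; simp; ring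

/-- The leading coefficient as a multiplicative map. -/
def LaurentSeries.leadingCoeffHom (F : Type*) [Field F] : LaurentSeries F →*₀ F where
  toFun := leadingCoeff
  map_zero' := leadingCoeff_zero
  map_one' := leadingCoeff_one
  map_mul' := fun x y ↦ leadingCoeff_mul x y

/-- If `C` acts on Laurent series through a character and `G` through the coefficients, this is
the resulting action of `G × C`. -/
def LaurentSeries.twistHom {G C : Type} [Group G] [Group C] (ρ : G →* (F →ₐ[K] F)) (χ : C →* Kˣ) :
    G × C →* (LaurentSeries F →ₐ[K] LaurentSeries F) where
  toFun h := twist (ρ h.1) (χ h.2)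
  map_one' := by ext; simp [coeff_twist]
  map_mul' a b := by
    ext f n
    simp [coeff_twist, mul_zpow, smul_smul]

/-- An order three twist which preserves all leading coefficients of `E` is trivial on `E`. -/
theorem LaurentSeries.twist_eq_self (h3 : (3 : F) ≠ 0) {E : IntermediateField K (LaurentSeries F)}
    {σ : F →ₐ[K] F} {u : Kˣ} (hE : ∀ f ∈ E, twist σ u f ∈ E)
    (hcube : ∀ f, twist σ u (twist σ u (twist σ u f)) = f)
    (hlead : ∀ f ∈ E, (twist σ u f).coeff f.order = f.coeff f.order) {f : LaurentSeries F}
    (hf : f ∈ E) : twist σ u f = f := by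
  by_contra hne
  set h := twist σ u f - f with hh
  have h0 : h ≠ 0 := sub_ne_zero.2 hne
  have h1 := hlead h (sub_mem (hE f hf) hf)
  have h2 : (twist σ u (twist σ u h)).coeff h.order = h.coeff h.order := by
    rw [coeff_twist, h1, ← coeff_twist, h1]
  have hsum : h + twist σ u h + twist σ u (twist σ u h) = 0 := by
    rw [hh]
    simp only [map_sub, hcube]
    abel
  have := congrArg (fun x ↦ x.coeff h.order) hsum
  simp only [coeff_add, h1, h2, coeff_zero] at this
  have h4 : (3 : F) * h.coeff h.order = 0 := by linear_combination this
  exact h0 (coeff_order_eq_zero.1 ((mul_eq_zero.1 h4).resolve_left h3))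

theorem LaurentSeries.exists_powerSeries {f : LaurentSeries F} (hf : 0 ≤ f.order) :
    ∃ y : PowerSeries F, ofPowerSeries ℤ F y = f ∧ PowerSeries.constantCoeff y = f.coeff 0 := by
  refine ⟨PowerSeries.mk fun n ↦ f.coeff n, ?_, by simp⟩
  ext n
  obtain ⟨n, rfl⟩ | hn := (em (0 ≤ n)).imp_left Int.eq_ofNat_of_zero_le
  · rw [ofPowerSeries_apply_coeff, PowerSeries.coeff_mk]
  · rw [coeff_eq_zero_of_lt_order (lt_of_not_ge fun h ↦ hn (hf.trans h)), ofPowerSeries_apply,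
      embDomain_of_notMem_range]
    rintro ⟨m, rfl⟩
    exact hn (Int.natCast_nonneg m)

/-- The constant coefficient as an algebra homomorphism. -/
def PowerSeries.constantCoeffAlg (K F : Type*) [Field K] [Field F] [Algebra K F] :
    PowerSeries F →ₐ[K] F where
  toRingHom := PowerSeries.constantCoeff
  commutes' r := by
    rw [IsScalarTower.algebraMap_apply K F (PowerSeries F)]
    simp

theorem LaurentSeries.leadingCoeff_twist (σ : F →ₐ[K] F) (u : Kˣ) (f : LaurentSeries F) :
    (twist σ u f).leadingCoeff = ((u ^ f.order : Kˣ) : K) • σ f.leadingCoeff := by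
  rw [leadingCoeff_eq, order_twist, coeff_twist, leadingCoeff_eq]

/-- The power series, inside the Laurent series. -/
def LaurentSeries.ofPowerSeriesHom (K F : Type*) [Field K] [Field F] [Algebra K F] :
    PowerSeries F →ₐ[K] LaurentSeries F where
  toRingHom := ofPowerSeries ℤ F
  commutes' _ := rfl

/-- The field of constant terms of the power series contained in `E`. -/
abbrev LaurentSeries.residueField (E : IntermediateField K (LaurentSeries F)) :
    IntermediateField K F :=
  IntermediateField.specialize (ofPowerSeriesHom K F) (PowerSeries.constantCoeffAlg K F) K E

theorem LaurentSeries.leadingCoeff_mem_residueField {E : IntermediateField K (LaurentSeries F)}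
    {f : LaurentSeries F} (hf : f ∈ E) (h0 : f.order = 0) : f.leadingCoeff ∈ residueField E := by
  obtain ⟨y, rfl, hy⟩ := exists_powerSeries h0.ge
  rw [leadingCoeff_eq, h0, ← hy]
  exact IntermediateField.mem_specialize (ι := ofPowerSeriesHom K F) hf

theorem LaurentSeries.trdeg_residueField_add_one_le {E : IntermediateField K (LaurentSeries F)}
    {f : LaurentSeries F} (hf : f ∈ E) (h0 : f.order ≠ 0) :
    Algebra.trdeg K (residueField E) + 1 ≤ Algebra.trdeg K E := by
  wlog hpos : 0 < f.order generalizing f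
  · exact this (inv_mem hf) (by rwa [order_inv, neg_ne_zero]) (by rw [order_inv]; omega)
  obtain ⟨y, rfl, hy⟩ := exists_powerSeries hpos.le
  refine IntermediateField.trdeg_specialize_add_one_le (ι := ofPowerSeriesHom K F)
    (φ := PowerSeries.constantCoeffAlg K F) (ofPowerSeries_injective) E hf ?_
    (hy.trans (coeff_eq_zero_of_lt_order hpos))
  rintro rfl
  simp at h0

theorem LaurentSeries.map_mem_residueField {E : IntermediateField K (LaurentSeries F)}
    {σ : F →ₐ[K] F} {u : Kˣ} (hE : ∀ f ∈ E, twist σ u f ∈ E) {x : F}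
    (hx : x ∈ residueField E) : σ x ∈ residueField E := by
  refine IntermediateField.map_mem_specialize (σ := twist σ u) (τ := σ) (fun y ↦ ?_) hE hx
  have hy : 0 ≤ (ofPowerSeries ℤ F y).order := by
    by_contra! h
    have h1 : ofPowerSeries ℤ F y = 0 := by
      rw [← coeff_order_eq_zero]
      conv_lhs => rw [ofPowerSeries_apply]
      rw [embDomain_of_notMem_range]
      rintro ⟨m, hm⟩
      exact (Int.natCast_nonneg m).not_gt (hm.trans_lt h)
    simp [h1] at h
  obtain ⟨y', h1, h2⟩ := exists_powerSeries (f := twist σ u (ofPowerSeries ℤ F y))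
    (by rwa [order_twist])
  refine ⟨y', h1, h2.trans ?_⟩
  have := ofPowerSeries_apply_coeff (Γ := ℤ) y 0
  rw [coeff_twist, ← Nat.cast_zero, this]
  simp [PowerSeries.constantCoeffAlg]

theorem LaurentSeries.twistHom_cube {G C : Type} [Group G] [Group C] (ρ : G →* (F →ₐ[K] F))
    (χ : C →* Kˣ) {h : G × C} (hh : h ^ 3 = 1) (f : LaurentSeries F) :
    twistHom ρ χ h (twistHom ρ χ h (twistHom ρ χ h f)) = f := by
  rw [← AlgHom.mul_apply, ← AlgHom.mul_apply, ← map_mul, ← map_mul, ← pow_three', hh, map_one,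
    AlgHom.one_apply]

open LaurentSeries in
/-- Specializing at the origin turns a compression of the twisted action on Laurent series into a
compression of the action on the coefficients, of smaller transcendence degree. -/
theorem HasCompression.of_twistHom {G C : Type} [Group G] [Group C] {ρ : G →* (F →ₐ[K] F)}
    {χ : C →* Kˣ} (h3 : (3 : F) ≠ 0)
    (hG : ∀ N : Subgroup G, N.Normal → N ≠ ⊥ → ∃ g ∈ N, g ≠ 1 ∧ g ^ 3 = 1) {c : C}
    (hc : c ^ 3 = 1) (hχ : IsPrimitiveRoot (χ c) 3) {d : ℕ}
    (hd : HasCompression (twistHom ρ χ) d) : ∃ d', d' + 1 ≤ d ∧ HasCompression ρ d' := by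
  obtain ⟨E, hE, hfaith, hdeg⟩ := hd
  have hself : ∀ h : G × C, h ^ 3 = 1 →
      (∀ f ∈ E, (twistHom ρ χ h f).leadingCoeff = f.leadingCoeff) → h = 1 := by
    intro h hh hlead
    by_contra h1
    obtain ⟨f, hf, hne⟩ := hfaith h h1
    refine hne (twist_eq_self h3 (hE h) (twistHom_cube ρ χ hh) (fun f hf ↦ ?_) hf)
    have := hlead f hf
    rwa [leadingCoeff_eq, leadingCoeff_eq, twistHom, MonoidHom.coe_mk, OneHom.coe_mk,
      order_twist] at this
  obtain ⟨f₁, hf₁, hn₁⟩ : ∃ f ∈ E, ¬ (3 : ℤ) ∣ f.order := by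
    by_contra! h
    have h1 := hself (1, c) (by simp [hc]) fun f hf ↦ by
      obtain ⟨m, hm⟩ := h f hf
      have : (χ c) ^ f.order = 1 := by
        rw [hm, zpow_mul, zpow_ofNat, hχ.pow_eq_one, one_zpow]
      change (twist (ρ 1) (χ c) f).leadingCoeff = _
      rw [leadingCoeff_twist, this]
      simp
    rw [Prod.mk_eq_one] at h1
    simp [h1.2] at hχ
  have htr := trdeg_residueField_add_one_le hf₁ (fun h ↦ hn₁ (by simp [h]))
  obtain ⟨d', hd'⟩ := Cardinal.lt_aleph0.1
    (((self_le_add_right _ _).trans (htr.trans hdeg)).trans_lt Cardinal.natCast_lt_aleph0)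
  refine ⟨d', ?_, residueField E, fun g x hx ↦ map_mem_residueField (hE (g, 1)) hx, ?_, hd'.le⟩
  · rw [hd'] at htr
    exact_mod_cast htr.trans hdeg
  by_contra! hnf
  obtain ⟨g₁, hg₁, hfix₁⟩ := hnf
  let N : Subgroup G :=
    { carrier := {g | ∀ x ∈ residueField E, ρ g x = x}
      mul_mem' := fun {a b} ha hb x hx ↦ by rw [map_mul, AlgHom.mul_apply, hb x hx, ha x hx]
      one_mem' := fun x _ ↦ by simp
      inv_mem' := fun {a} ha x hx ↦ by
        conv_lhs => rw [← ha x hx]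
        rw [← AlgHom.mul_apply, ← map_mul]
        simp }
  have hN : N.Normal := ⟨fun n hn g x hx ↦ by
    have := hn _ (map_mem_residueField (hE (g⁻¹, 1)) hx)
    change ρ n (ρ g⁻¹ x) = ρ g⁻¹ x at this
    rw [map_mul, map_mul, AlgHom.mul_apply, AlgHom.mul_apply, this, ← AlgHom.mul_apply, ← map_mul]
    simp⟩
  obtain ⟨g, hgN, hg1, hg3⟩ := hG N hN ((N.ne_bot_iff_exists_ne_one).2
    ⟨⟨g₁, hfix₁⟩, fun h ↦ hg₁ (congrArg Subtype.val h)⟩)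
  have hfix : ∀ f ∈ E, f.order = 0 → ρ g f.leadingCoeff = f.leadingCoeff := fun f hf h0 ↦
    hgN _ (leadingCoeff_mem_residueField hf h0)
  have hb : ∀ f ∈ E, f ≠ 0 → ∃ b : F, ρ g f.leadingCoeff = b * f.leadingCoeff ∧ b ^ 3 = 1 := by
    intro f hf hf0
    have hlc : f.leadingCoeff ≠ 0 := leadingCoeff_ne_zero.2 hf0
    have ht : twist (ρ g) 1 f ∈ E := by simpa [twistHom] using hE (g, 1) f hf
    have hord : (twist (ρ g) 1 f / f).order = 0 := by
      rw [div_eq_mul_inv, order_mul (by simpa using hf0) (inv_ne_zero hf0), order_inv, order_twist]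
      ring
    have hb := hfix _ (div_mem ht hf) hord
    have hl : (twist (ρ g) 1 f / f).leadingCoeff = ρ g f.leadingCoeff / f.leadingCoeff := by
      refine (map_div₀ (leadingCoeffHom F) _ _).trans ?_
      change (twist (ρ g) 1 f).leadingCoeff / f.leadingCoeff = _
      rw [leadingCoeff_twist]
      simp
    rw [hl] at hb
    set b := ρ g f.leadingCoeff / f.leadingCoeff with hbdef
    have h1 : ρ g f.leadingCoeff = b * f.leadingCoeff := (div_mul_cancel₀ _ hlc).symm
    refine ⟨b, h1, ?_⟩
    have h4 : ρ (g ^ 3) f.leadingCoeff = b ^ 3 * f.leadingCoeff := by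
      rw [pow_three, map_mul, map_mul, AlgHom.mul_apply, AlgHom.mul_apply, h1, map_mul, map_mul,
        hb, h1, map_mul, hb, h1]
      ring
    rw [hg3, map_one, AlgHom.one_apply] at h4
    exact mul_right_cancel₀ hlc (h4.symm.trans (one_mul _).symm)
  have hf₁0 : f₁ ≠ 0 := fun h ↦ hn₁ (by simp [h])
  obtain ⟨b₁, hb₁, hb₁3⟩ := hb f₁ hf₁ hf₁0
  set n₁ := f₁.order
  have hcop : IsCoprime n₁ 3 := (Int.prime_three.coprime_iff_not_dvd.2 hn₁).symm
  let z : F := algebraMap K F (χ c)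
  have hz : IsPrimitiveRoot z 3 :=
    (IsPrimitiveRoot.coe_units_iff.2 hχ).map_of_injective (algebraMap K F).injective
  have hb₁0 : b₁ ≠ 0 := by
    rintro rfl
    simp at hb₁3
  have hsmul : ∀ (n : ℤ) (x : F), ((χ c ^ n : Kˣ) : K) • x = z ^ n * x := by
    intro n x
    rw [Algebra.smul_def]
    simp [z]
  obtain ⟨k, hk⟩ : ∃ k : ℕ, z ^ (n₁ * k) * b₁ = 1 := by
    have hzn := hz.zpow_of_gcd_eq_one n₁ (Int.isCoprime_iff_gcd_eq_one.1 hcop)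
    obtain ⟨k, -, hk⟩ := hzn.eq_pow_of_pow_eq_one (ξ := b₁⁻¹) (by rw [inv_pow, hb₁3, inv_one])
    exact ⟨k, by rw [zpow_mul, zpow_natCast, hk, inv_mul_cancel₀ hb₁0]⟩
  have hgck : (g, c ^ k) ^ 3 = 1 := by
    rw [Prod.pow_mk, hg3, ← pow_mul, mul_comm, pow_mul, hc, one_pow, Prod.mk_one_one]
  have hgc := hself (g, c ^ k) hgck fun f hf ↦ by
    by_cases hf0 : f = 0
    · simp [hf0]
    obtain ⟨b, hbf, hb3⟩ := hb f hf hf0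
    change (twist (ρ g) (χ (c ^ k)) f).leadingCoeff = _
    rw [leadingCoeff_twist, map_pow, ← zpow_natCast, ← zpow_mul, hsmul, hbf]
    set m := f.order
    have hw : (f ^ n₁ * (f₁ ^ m)⁻¹).order = 0 := by
      rw [order_mul (zpow_ne_zero _ hf0) (inv_ne_zero (zpow_ne_zero _ hf₁0)), order_inv,
        order_zpow, order_zpow]
      ring
    have h4 := hfix _ (mul_mem (zpow_mem hf _) (inv_mem (zpow_mem hf₁ _))) hw
    have hl : (f ^ n₁ * (f₁ ^ m)⁻¹).leadingCoeff =
        f.leadingCoeff ^ n₁ * (f₁.leadingCoeff ^ m)⁻¹ := by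
      change leadingCoeffHom F _ = _
      rw [map_mul, map_inv₀, map_zpow₀, map_zpow₀]
      rfl
    rw [hl, map_mul, map_inv₀, map_zpow₀, map_zpow₀, hbf, hb₁, mul_zpow, mul_zpow] at h4
    have ha := zpow_ne_zero n₁ (leadingCoeff_ne_zero.2 hf0)
    have ha₁ := zpow_ne_zero m (leadingCoeff_ne_zero.2 hf₁0)
    have hbb : b ^ n₁ = b₁ ^ m := by
      have := zpow_ne_zero m hb₁0
      field_simp at h4
      exact h4
    have hy3 : (z ^ (k * m) * b) ^ (3 : ℤ) = 1 := by
      rw [mul_zpow, ← zpow_mul, mul_comm, mul_comm _ (3 : ℤ), zpow_mul, zpow_ofNat, zpow_ofNat,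
        hb3, hz.pow_eq_one, one_zpow, one_mul]
    have hyn : (z ^ (k * m) * b) ^ n₁ = 1 := by
      rw [mul_zpow, hbb, ← zpow_mul, mul_comm (k * m : ℤ), ← mul_assoc, zpow_mul, ← mul_zpow, hk,
        one_zpow]
    have hy0 : z ^ (k * m) * b ≠ 0 := by
      intro h
      simp [h] at hy3
    obtain ⟨r, s, hrs⟩ := hcop
    have hy : z ^ (k * m) * b = 1 := by
      rw [← zpow_one (z ^ (k * m) * b), ← hrs, zpow_add₀ hy0, mul_comm r, mul_comm s,
        zpow_mul _ n₁, zpow_mul _ 3, hyn, hy3, one_zpow, one_zpow, one_mul]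
    rw [← mul_assoc, hy, one_mul]
  exact hg1 (congrArg Prod.fst hgc)

end Laurent

section Embedding
open Matrix

/-- The action of `G` on the first factor of `G × Y` by left translation. -/
def leftTranslation (G Y : Type*) [Group G] : G →* Equiv.Perm (G × Y) where
  toFun g := (Equiv.mulLeft g).prodCongr (Equiv.refl Y)
  map_one' := by ext <;> simp
  map_mul' a b := by ext <;> simp [mul_assoc]

/-- Decomposing the regular representation of `C` into characters: the `K`-linear change of
variables `x_{(g, c)} ↦ ∑ⱼ χ(c)ʲ x_{(g, j)}` is injective. -/
theorem MvPolynomial.aeval_sum_smul_injective {K : Type u} [Field K] {G C : Type} [Group C]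
    {n : ℕ} (e : Fin n ≃ C) {χ : C →* Kˣ} (hχ : Function.Injective χ) :
    Function.Injective (aeval (R := K) fun p : G × C ↦ ∑ j : Fin n,
      ((χ p.2 : K) ^ (j : ℕ)) • (X (p.1, j) : MvPolynomial (G × Fin n) K)) := by
  let V := vandermonde fun i ↦ (χ (e i) : K)
  have hV : IsUnit V.det := (det_vandermonde_ne_zero_iff.2 fun i j h ↦
    e.injective (hχ (Units.ext h))).isUnit
  let β : MvPolynomial (G × Fin n) K →ₐ[K] MvPolynomial (G × C) K :=
    aeval fun p ↦ ∑ i, V⁻¹ p.2 i • X (p.1, e i)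
  refine Function.LeftInverse.injective (g := β) fun Q ↦ ?_
  rw [← AlgHom.comp_apply]
  refine DFunLike.congr_fun (f := β.comp _) (g := AlgHom.id K _) (MvPolynomial.algHom_ext ?_) Q
  rintro ⟨g, c⟩
  obtain ⟨i, rfl⟩ := e.surjective c
  simp only [AlgHom.comp_apply, aeval_X, map_sum, map_smul, β, Finset.smul_sum, smul_smul,
    AlgHom.id_apply]
  rw [Finset.sum_comm]
  simp only [← Finset.sum_smul]
  have h1 : ∀ l, ∑ j : Fin n, (χ (e i) : K) ^ (j : ℕ) * V⁻¹ j l = (1 : Matrix _ _ K) i l := by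
    intro l
    rw [← mul_nonsing_inv V hV, mul_apply]
    rfl
  simp only [h1, one_apply, ite_smul, one_smul, zero_smul, Finset.sum_ite_eq, Finset.mem_univ,
    if_true]

theorem LaurentSeries.twist_single {K F : Type u} [Field K] [Field F] [Algebra K F]
    (σ : F →ₐ[K] F) (u : Kˣ) (n : ℤ) (a : F) :
    twist σ u (HahnSeries.single n a) = HahnSeries.single n (((u ^ n : Kˣ) : K) • σ a) := by
  ext m
  rw [coeff_twist]
  by_cases h : m = n
  · simp [h]
  · simp [HahnSeries.coeff_single_of_ne h]

/-- A compression of the regular representation of `G × C` yields one of the twisted action on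
Laurent series. -/
theorem HasCompression.twistHom {K : Type u} [Field K] {G C : Type} [Group G] [Group C] [Finite G]
    [Finite C] {n : ℕ} (e : Fin n ≃ C) {χ : C →* Kˣ} (hχ : Function.Injective χ) {d : ℕ}
    (hd : HasCompression (permAlgHom K (MulAction.toPermHom (G × C) (G × C))) d) :
    HasCompression (LaurentSeries.twistHom (permAlgHom K (leftTranslation G (Fin n))) χ) d := by
  let x : G × Fin n → FnField K (G × Fin n) := fun p ↦
    algebraMap (MvPolynomial (G × Fin n) K) _ (MvPolynomial.X p)
  let P : G × C → Polynomial (FnField K (G × Fin n)) := fun p ↦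
    ∑ j : Fin n, Polynomial.C (((χ p.2 : K) ^ (j : ℕ)) • x (p.1, j)) * Polynomial.X ^ (j : ℕ)
  let ψ : Polynomial (FnField K (G × Fin n)) →ₐ[K] LaurentSeries (FnField K (G × Fin n)) :=
    { toRingHom := algebraMap _ _
      commutes' := fun r ↦ by
        rw [HahnSeries.algebraMap_apply']
        simp [Polynomial.algebraMap_hahnSeries_apply, PowerSeries.algebraMap_apply,
          Polynomial.algebraMap_apply] }
  have hψ : ∀ (j : ℕ) a, ψ (Polynomial.C a * Polynomial.X ^ j) = HahnSeries.single (j : ℤ) a := by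
    intro j a
    change algebraMap _ _ _ = _
    simp [Polynomial.algebraMap_hahnSeries_apply]
  have := IsScalarTower.of_algebraMap_eq (R := K) (S := K)
    (A := LaurentSeries (FnField K (G × Fin n))) fun _ ↦ rfl
  refine hd.of_specialization fun Q hQ ↦ ⟨fun p ↦ ψ (P p), ?_, fun h0 ↦ hQ ?_⟩
  · rintro ⟨g, c⟩ ⟨g', c'⟩
    simp only [P, map_sum, hψ]
    refine Finset.sum_congr rfl fun j _ ↦ ?_
    refine .trans ?_ (LaurentSeries.twist_single _ _ _ _).symm
    congr 1
    simp only [map_smul, x, permAlgHom_algebraMap, smul_smul]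
    rw [MvPolynomial.rename_X]
    congr 1
    simp [mul_pow]
  · apply MvPolynomial.aeval_sum_smul_injective e hχ
    rw [map_zero]
    apply FaithfulSMul.algebraMap_injective _ (FnField K (G × Fin n))
    have hP : MvPolynomial.aeval P Q = 0 := by
      apply (HahnSeries.ofPowerSeries_injective (Γ := ℤ)).comp (Polynomial.coe_injective _)
      exact (MvPolynomial.comp_aeval_apply P ψ Q).trans (h0.trans (map_zero ψ).symm)
    have h1 := congrArg ((Polynomial.aeval (1 : FnField K (G × Fin n))).restrictScalars K) hP
    rw [MvPolynomial.comp_aeval_apply, map_zero] at h1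
    rw [map_zero, ← h1, ← IsScalarTower.coe_toAlgHom' K]
    refine (MvPolynomial.comp_aeval_apply _ _ Q).trans ?_
    congr 2
    ext p
    simp [P, x]

end Embedding

section AlternatingGroup

theorem edK_add_one_le {K : Type u} [Field K] {G C Γ : Type} [Group G] [Group C] [Group Γ]
    [Finite Γ] {f : G × C →* Γ} (hf : Function.Injective f) {χ : C →* Kˣ}
    (hχ : Function.Injective χ) (hC : Nat.card C = 3) (h3 : (3 : K) ≠ 0)
    (hG : ∀ N : Subgroup G, N.Normal → N ≠ ⊥ → ∃ g ∈ N, g ≠ 1 ∧ g ^ 3 = 1) :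
    edK K G + 1 ≤ edK K Γ := by
  have : Finite (G × C) := Finite.of_injective f hf
  have : Finite G := Finite.of_injective (fun g ↦ (g, (1 : C))) (Prod.mk_left_injective 1)
  have : Finite C := Nat.finite_of_card_ne_zero (by simp [hC])
  obtain ⟨c, hc⟩ := exists_prime_orderOf_dvd_card' (G := C) 3 hC.symm.dvd
  obtain ⟨d, hd, hcomp⟩ := (((hasCompression_edK K Γ).regular_of_injective hf).twistHom
    (Finite.equivFinOfCardEq hC).symm hχ).of_twistHom
    (map_ofNat (algebraMap K (FnField K (G × Fin 3))) 3 ▸ (map_ne_zero _).2 h3) hG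
    (orderOf_dvd_iff_pow_eq_one.1 hc.dvd)
    (by rw [← hc, ← orderOf_injective χ hχ]; exact IsPrimitiveRoot.orderOf _)
  exact (Nat.add_le_add_right (hcomp.to_regular (n := 3) id Function.injective_id
    fun _ _ ↦ rfl).edK_le 1).trans hd

theorem edK_le_of_injective {K : Type u} [Field K] {G H : Type} [Group G] [Group H] [Finite G]
    {f : H →* G} (hf : Function.Injective f) : edK K H ≤ edK K G :=
  ((hasCompression_edK K G).regular_of_injective hf).edK_le

theorem edK_le_of_algebra (K k : Type u) [Field K] [Field k] [Algebra K k] (G : Type) [Group G]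
    [Finite G] : edK k G ≤ edK K G :=
  (hasCompression_edK K G).baseChange.edK_le

/-- The block embedding of a product of alternating groups. -/
def alternatingGroup.prodHom (m n : ℕ) :
    alternatingGroup (Fin m) × alternatingGroup (Fin n) →* alternatingGroup (Fin (m + n)) :=
  ((finSumFinEquiv.permCongrHom.toMonoidHom.comp (Equiv.Perm.sumCongrHom (Fin m) (Fin n))).comp
    ((alternatingGroup (Fin m)).subtype.prodMap (alternatingGroup (Fin n)).subtype)).codRestrict
    (alternatingGroup (Fin (m + n))) fun p ↦ by
      have h1 := Equiv.Perm.mem_alternatingGroup.1 p.1.2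
      have h2 := Equiv.Perm.mem_alternatingGroup.1 p.2.2
      simp [Equiv.Perm.mem_alternatingGroup, h1, h2]

theorem alternatingGroup.prodHom_injective (m n : ℕ) :
    Function.Injective (alternatingGroup.prodHom m n) := by
  refine MonoidHom.injective_codRestrict _ _ _ |>.2 ?_
  refine (finSumFinEquiv.permCongrHom.injective.comp Equiv.Perm.sumCongrHom_injective).comp ?_
  exact Subtype.val_injective.prodMap Subtype.val_injective

theorem nat_card_alternatingGroup_fin_three : Nat.card (alternatingGroup (Fin 3)) = 3 := by
  rw [nat_card_alternatingGroup]
  simp [Nat.factorial]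

theorem alternatingGroup.exists_pow_three_eq_one {n : ℕ} (hn : n ≠ 4)
    (N : Subgroup (alternatingGroup (Fin n))) (hN : N.Normal) (hbot : N ≠ ⊥) :
    ∃ g ∈ N, g ≠ 1 ∧ g ^ 3 = 1 := by
  have hcard : 3 ≤ n → 3 ∣ Nat.card (alternatingGroup (Fin n)) := by
    intro h
    have : Nontrivial (Fin n) := Fin.nontrivial_iff_two_le.2 (by omega)
    have h2 := two_mul_nat_card_alternatingGroup (α := Fin n)
    rw [Nat.card_perm, Nat.card_fin] at h2
    exact (Nat.Coprime.dvd_mul_left (by norm_num)).1 (h2 ▸ Nat.dvd_factorial (by norm_num) h)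
  obtain hn' | rfl | hn' : n ≤ 2 ∨ n = 3 ∨ 5 ≤ n := by omega
  · have : Subsingleton (alternatingGroup (Fin n)) := by
      interval_cases n <;> exact ⟨by decide⟩
    exact absurd (Subsingleton.elim _ _) hbot
  · obtain ⟨⟨g, hg⟩, hne⟩ := N.ne_bot_iff_exists_ne_one.1 hbot
    refine ⟨g, hg, fun h ↦ hne (Subtype.ext h), ?_⟩
    simpa only [nat_card_alternatingGroup_fin_three] using pow_card_eq_one' (x := g)
  · have := alternatingGroup.isSimpleGroup (α := Fin n) (by simpa)
    obtain rfl := (hN.eq_bot_or_eq_top).resolve_left hbot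
    obtain ⟨g, hg⟩ := exists_prime_orderOf_dvd_card' 3 (hcard (by omega))
    refine ⟨g, trivial, ?_, orderOf_dvd_iff_pow_eq_one.1 hg.dvd⟩
    rintro rfl
    simp at hg

theorem edK_alternatingGroup_add_one_le {K : Type u} [Field K] {ζ : K} (hζ : IsPrimitiveRoot ζ 3)
    (h3 : (3 : K) ≠ 0) {n : ℕ} (hn : n ≠ 4) :
    edK K (alternatingGroup (Fin n)) + 1 ≤ edK K (alternatingGroup (Fin (n + 3))) := by
  have hζ' := hζ.isUnit_unit (by simp)
  let χ := (Subgroup.zpowers (hζ.isUnit (by simp)).unit).subtype.comp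
    (mulEquivOfPrimeCardEq nat_card_alternatingGroup_fin_three
      ((Nat.card_zpowers _).trans hζ'.eq_orderOf.symm)).toMonoidHom
  refine edK_add_one_le (alternatingGroup.prodHom_injective n 3) (χ := χ) ?_
    nat_card_alternatingGroup_fin_three h3 (alternatingGroup.exists_pow_three_eq_one hn)
  exact Subtype.val_injective.comp (MulEquiv.injective _)

theorem le_edK_alternatingGroup {K : Type u} [Field K] {ζ : K} (hζ : IsPrimitiveRoot ζ 3)
    (h3 : (3 : K) ≠ 0) (n : ℕ) : n / 3 ≤ edK K (alternatingGroup (Fin n)) := by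
  have h : ∀ m, m ≤ edK K (alternatingGroup (Fin (3 * m))) := by
    intro m
    induction m with
    | zero => exact Nat.zero_le _
    | succ m ih =>
      exact (Nat.succ_le_succ ih).trans (edK_alternatingGroup_add_one_le hζ h3 (by omega))
  have := edK_le_of_injective (K := K)
    (f := (alternatingGroup.prodHom (3 * (n / 3)) (n % 3)).comp (MonoidHom.inl _ _))
    ((alternatingGroup.prodHom_injective _ _).comp (Prod.mk_left_injective 1))
  rw [Nat.div_add_mod] at this
  exact (h _).trans this

end AlternatingGroup

/-- (a) If `K ⊇ F₄` (i.e. `char K = 2` and `K` contains a primitive cube root of unity),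
then `ed_K(A_{n+3}) ≥ ed_K(Aₙ) + 1` for every `n ≥ 3` with `n ≠ 4`.
(b) If `char K = 2`, then `ed_K(Aₙ) ≥ ⌊n/3⌋` for every `n ≥ 3`. -/
theorem edK_alternatingGroup_char_two :
    (∀ (K : Type u) [Field K], ringChar K = 2 → (∃ ζ : K, IsPrimitiveRoot ζ 3) →
      ∀ n : ℕ, 3 ≤ n → n ≠ 4 →
        edK K ↥(alternatingGroup (Fin n)) + 1 ≤ edK K ↥(alternatingGroup (Fin (n + 3)))) ∧
    (∀ (K : Type u) [Field K], ringChar K = 2 →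
      ∀ n : ℕ, 3 ≤ n → n / 3 ≤ edK K ↥(alternatingGroup (Fin n))) := by
  have h3 : ∀ (K : Type u) [Field K], ringChar K = 2 → (3 : K) ≠ 0 := by
    intro K _ hK
    have := ringChar.of_eq hK
    rw [show (3 : K) = 2 + 1 by norm_num, CharTwo.two_eq_zero, zero_add]
    exact one_ne_zero
  refine ⟨fun K _ hK ⟨ζ, hζ⟩ n _ hn ↦ edK_alternatingGroup_add_one_le hζ (h3 K hK) hn,
    fun K _ hK n _ ↦ ?_⟩
  have : NeZero (3 : AlgebraicClosure K) :=
    ⟨map_ofNat (algebraMap K (AlgebraicClosure K)) 3 ▸ (map_ne_zero _).2 (h3 K hK)⟩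
  obtain ⟨ζ, hζ⟩ := HasEnoughRootsOfUnity.exists_primitiveRoot (AlgebraicClosure K) 3
  exact (le_edK_alternatingGroup hζ (NeZero.ne _) n).trans
    (edK_le_of_algebra K (AlgebraicClosure K) _)
end
end

section
/- Let K be a field, n ≥ 1 an integer, and D_n the dihedral group of order 2n. (1) If char K ≠ 2, then ed_K(D_n) = 1 if and only if both of the following hold: (i) n is odd, and (ii) if char K does not divide n then ζ + ζ⁻¹ ∈ K for some primitive n-th root of unity ζ in an algebraic closure of K, while if char K = p > 0 divides n then n = p. (2) If char K = 2, then ed_K(D_n) = 1 if and only if either n is odd and ζ + ζ⁻¹ ∈ K for some primitive n-th root of unity ζ in an algebraic closure of K, or n = 2 and K has at least 4 elements. -/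
noncomputable section

section Matrices

variable {K : Type*} [Field K]

/-- A square-two matrix satisfies its characteristic equation. -/
theorem mat_sq (M : Matrix (Fin 2) (Fin 2) K) : M * M = M.trace • M - M.det • 1 := by
  ext i j
  fin_cases i <;> fin_cases j <;>
    simp [Matrix.mul_apply, Fin.sum_univ_two, Matrix.trace_fin_two, Matrix.det_fin_two] <;> ring

/-- Anything commuting with a nonscalar `2 × 2` matrix `M` lies in `K[M]`. -/
theorem exists_eq_of_commute {M A : Matrix (Fin 2) (Fin 2) K} (hM : ∀ c : K, M ≠ c • 1)
    (h : M * A = A * M) : ∃ a b : K, A = a • 1 + b • M := by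
  have h00 := congrFun (congrFun h 0) 0
  have h01 := congrFun (congrFun h 0) 1
  have h10 := congrFun (congrFun h 1) 0
  simp only [Matrix.mul_apply, Fin.sum_univ_two] at h00 h01 h10
  by_cases hb : M 0 1 = 0
  · by_cases hc : M 1 0 = 0
    · have hd : M 0 0 - M 1 1 ≠ 0 := by
        intro hd
        apply hM (M 0 0)
        ext i j
        fin_cases i <;> fin_cases j <;> simp [hb, hc]
        linear_combination -hd
      refine ⟨A 0 0 - (A 0 0 - A 1 1) / (M 0 0 - M 1 1) * M 0 0,
        (A 0 0 - A 1 1) / (M 0 0 - M 1 1), ?_⟩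
      simp only [hb, hc] at h01 h10
      have e1 : A 0 1 = 0 := by
        apply mul_left_cancel₀ hd; linear_combination h01
      have e2 : A 1 0 = 0 := by
        apply mul_left_cancel₀ hd; linear_combination -h10
      ext i j
      fin_cases i <;> fin_cases j <;> simp [hb, hc, e1, e2]
      field_simp
      ring
    · refine ⟨A 0 0 - A 1 0 / M 1 0 * M 0 0, A 1 0 / M 1 0, ?_⟩
      ext i j
      fin_cases i <;> fin_cases j <;> simp [hc]
      · field_simp
        linear_combination -h00
      · field_simp
        linear_combination -h10
  · refine ⟨A 0 0 - A 0 1 / M 0 1 * M 0 0, A 0 1 / M 0 1, ?_⟩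
    ext i j
    fin_cases i <;> fin_cases j <;> simp [hb]
    · field_simp
      linear_combination h00
    · field_simp
      linear_combination h01

/-- A nonscalar involution in `GL₂` has trace zero and determinant `-1`. -/
theorem trace_det_of_sq_eq_one {M : Matrix (Fin 2) (Fin 2) K} (hM : ∀ c : K, M ≠ c • 1)
    (h : M * M = 1) : M.trace = 0 ∧ M.det = -1 := by
  have h1 := mat_sq M
  rw [h] at h1
  have ht : M.trace = 0 := by
    by_contra ht
    apply hM (M.trace⁻¹ * (1 + M.det))
    rw [mul_smul, eq_inv_smul_iff₀ ht, add_smul, one_smul]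
    exact (eq_sub_iff_add_eq.1 h1).symm
  refine ⟨ht, ?_⟩
  have := congrFun (congrFun h1 0) 0
  simp [ht] at this
  linear_combination this

/-- Nilpotent `2 × 2` matrices square to zero. -/
theorem mul_self_eq_zero_of_pow {N : Matrix (Fin 2) (Fin 2) K} {p : ℕ} (h : N ^ p = 0) :
    N * N = 0 := by
  have hd : N.det = 0 := by
    have := congrArg Matrix.det h
    rw [Matrix.det_pow] at this
    rcases eq_or_ne p 0 with rfl | hp
    · simp at this
    · rw [Matrix.det_zero] at this
      exact pow_eq_zero_iff hp |>.1 this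
  have hsq := mat_sq N
  rw [hd, zero_smul, sub_zero] at hsq
  have hpow : ∀ k : ℕ, N ^ (k + 1) = N.trace ^ k • N := by
    intro k
    induction k with
    | zero => simp
    | succ k ih => rw [pow_succ, ih, Matrix.smul_mul, hsq, smul_smul, pow_succ]
  have h' : N.trace ^ p • N = 0 := by rw [← hpow, pow_succ, h, zero_mul]
  rcases smul_eq_zero.1 h' with h0 | h0
  · rw [hsq, eq_zero_of_pow_eq_zero h0, zero_smul]
  · simp [h0]

/-- If `p = char K` and `M` is a nonscalar matrix with `M ^ p = 1`, everything commuting with `M` has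
scalar `p`-th power. -/
theorem pow_char_eq_smul_one {p : ℕ} [Fact p.Prime] [CharP K p] {M A : Matrix (Fin 2) (Fin 2) K}
    (hM : ∀ c : K, M ≠ c • 1) (hp : M ^ p = 1) (h : M * A = A * M) : ∃ c : K, A ^ p = c • 1 := by
  have hN : (M - 1) ^ p = 0 := by
    rw [sub_pow_char_of_commute (p := p) (Commute.one_right M), hp, one_pow, sub_self]
  have hN2 := mul_self_eq_zero_of_pow hN
  obtain ⟨a, b, rfl⟩ := exists_eq_of_commute hM h
  refine ⟨(a + b) ^ p, ?_⟩
  have e : a • (1 : Matrix (Fin 2) (Fin 2) K) + b • M = (a + b) • 1 + b • (M - 1) := by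
    rw [smul_sub, add_smul]; abel
  rw [e, add_pow_char_of_commute (p := p)]
  · rw [smul_pow, smul_pow, hN, one_pow, smul_zero, add_zero]
  · exact ((Commute.one_left _).smul_left _)

/-- Over a field containing the distinct eigenvalues `l, m` of `A`, if `l ^ k = m ^ k = 1`
then `A ^ k = 1`. -/
theorem pow_eq_one_of_roots {A : Matrix (Fin 2) (Fin 2) K} {l m : K} (hlm : l ≠ m)
    (ht : A.trace = l + m) (hd : A.det = l * m) {k : ℕ} (hl : l ^ k = 1) (hm : m ^ k = 1) :
    A ^ k = 1 := by
  open Polynomial in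
  have hdvd : (X - C l) * (X - C m) ∣ (X ^ k - 1 : K[X]) := by
    refine IsCoprime.mul_dvd (isCoprime_X_sub_C_of_isUnit_sub (sub_ne_zero.2 hlm).isUnit) ?_ ?_ <;>
      rw [dvd_iff_isRoot] <;> simp [hl, hm]
  obtain ⟨q, hq⟩ := hdvd
  have h0 : Polynomial.aeval A ((Polynomial.X - Polynomial.C l) *
      (Polynomial.X - Polynomial.C m)) = 0 := by
    have e := mat_sq A
    simp only [map_mul, map_sub, Polynomial.aeval_X, Polynomial.aeval_C,
      Algebra.algebraMap_eq_smul_one]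
    simp only [sub_mul, mul_sub, e, ht, hd, Matrix.mul_smul, Matrix.smul_mul, mul_one, one_mul,
      add_smul, mul_smul, smul_comm m l]
    abel
  have := congrArg (Polynomial.aeval A) hq
  rw [map_mul, h0, zero_mul] at this
  simpa [sub_eq_zero] using this

/-- If `A ^ k` is the scalar `c`, so is the `k`-th power of any eigenvalue. -/
theorem pow_eq_of_pow_eq_smul {A : Matrix (Fin 2) (Fin 2) K} {l m : K}
    (ht : A.trace = l + m) (hd : A.det = l * m) {k : ℕ} {c : K} (h : A ^ k = c • 1) :
    l ^ k = c := by
  have h1 : (A - l • 1) ∣ (A ^ k - (l • (1 : Matrix (Fin 2) (Fin 2) K)) ^ k) :=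
    ((Commute.one_right A).smul_right l).sub_dvd_pow_sub_pow k
  obtain ⟨q, hq⟩ := h1
  have hdet : (A - l • 1).det = 0 := by
    rw [Matrix.det_fin_two] at hd ⊢
    rw [Matrix.trace_fin_two] at ht
    simp
    linear_combination hd - l * ht
  have := congrArg Matrix.det hq
  rw [Matrix.det_mul, hdet, zero_mul, h, smul_pow, one_pow, ← sub_smul] at this
  simp at this
  linear_combination -this

end Matrices

section DihedralRepresentations

open DihedralGroup

variable {K : Type*} [Field K] {n : ℕ}

theorem DihedralGroup.r_ne_one_of_lt {k : ℕ} (h0 : 0 < k) (hk : k < n) :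
    (r (k : ZMod n) : DihedralGroup n) ≠ 1 := by
  rw [← r_zero, Ne, r.injEq, ZMod.natCast_eq_zero_iff]
  exact Nat.not_dvd_of_pos_of_lt h0 hk

theorem DihedralGroup.sr_ne_one (i : ZMod n) : (sr i : DihedralGroup n) ≠ 1 := by
  rw [← r_zero]
  exact fun h => by cases h

/-- A projectively faithful two-dimensional representation of `Dₙ` outside characteristic two forces
`n` to be odd. -/
theorem odd_of_nonscalar (ρ : DihedralGroup n →* Matrix (Fin 2) (Fin 2) K)
    (hρ : ∀ g, g ≠ 1 → ∀ c : K, ρ g ≠ c • 1) (hn : 1 ≤ n) (h2 : (2 : K) ≠ 0) : Odd n := by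
  by_contra hodd
  obtain ⟨m, rfl⟩ := (Nat.not_odd_iff_even.1 hodd)
  have hm : 0 < m := by omega
  have hmm : ((m : ZMod (m + m)) + m) = 0 := by
    rw [← Nat.cast_add]; exact ZMod.natCast_self _
  have h1 := trace_det_of_sq_eq_one (hρ _ (r_ne_one_of_lt (n := m + m) hm (by omega)))
    (by rw [← map_mul, r_mul_r, hmm, r_zero, map_one])
  have h3 := trace_det_of_sq_eq_one (hρ _ (sr_ne_one (0 : ZMod (m + m))))
    (by rw [← map_mul, sr_mul_self, map_one])
  have h4 := trace_det_of_sq_eq_one (hρ _ (sr_ne_one (m : ZMod (m + m))))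
    (by rw [← map_mul, sr_mul_self, map_one])
  have h5 : ρ (sr (m : ZMod (m + m))) = ρ (sr 0) * ρ (r m) := by
    rw [← map_mul, sr_mul_r, zero_add]
  have h6 := h4.2
  rw [h5, Matrix.det_mul, h1.2, h3.2] at h6
  apply h2
  linear_combination h6

/-- In characteristic `p`, a projectively faithful two-dimensional representation of `Dₙ` with
`p ∣ n` forces `n = p`. -/
theorem eq_char_of_nonscalar {p : ℕ} [Fact p.Prime] [CharP K p]
    (ρ : DihedralGroup n →* Matrix (Fin 2) (Fin 2) K)
    (hρ : ∀ g, g ≠ 1 → ∀ c : K, ρ g ≠ c • 1) (hn : 1 ≤ n) (hp : p ∣ n) : n = p := by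
  obtain ⟨m, rfl⟩ := hp
  have hpp : p.Prime := Fact.out
  have hm : 0 < m := Nat.pos_of_ne_zero (by rintro rfl; simp at hn)
  have hlt : m < p * m := by nlinarith [hpp.two_le]
  obtain ⟨c, hc⟩ := pow_char_eq_smul_one (p := p) (A := ρ (r 1))
    (hρ _ (r_ne_one_of_lt hm hlt))
    (by
      have : (m : ZMod (p * m)) * (p : ZMod (p * m)) = 0 := by
        rw [mul_comm, ← Nat.cast_mul, ZMod.natCast_self]
      rw [← map_pow, r_pow, this, r_zero, map_one])
    (by rw [← map_mul, ← map_mul, r_mul_r, r_mul_r, add_comm])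
  rw [← map_pow, r_one_pow] at hc
  by_contra hne
  refine hρ _ (r_ne_one_of_lt hpp.pos (lt_of_le_of_ne (Nat.le_of_dvd hn ⟨m, rfl⟩) ?_)) c hc
  exact fun h => hne h.symm

/-- In characteristic two, a projectively faithful two-dimensional representation of the Klein
four-group needs at least four scalars. -/
theorem four_le_card_of_nonscalar [CharP K 2]
    (ρ : DihedralGroup 2 →* Matrix (Fin 2) (Fin 2) K)
    (hρ : ∀ g, g ≠ 1 → ∀ c : K, ρ g ≠ c • 1) : 4 ≤ Cardinal.mk K := by
  have h2 : (2 : K) = 0 := CharP.cast_eq_zero K 2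
  have hA := hρ (r (1 : ℕ)) (r_ne_one_of_lt one_pos one_lt_two)
  have hB := hρ (sr 0) (sr_ne_one 0)
  have hAB := hρ (sr 1) (sr_ne_one 1)
  rw [Nat.cast_one] at hA
  have hAA : ρ (r 1) * ρ (r 1) = 1 := by
    rw [← map_mul, r_mul_r, ← map_one ρ, ← r_zero]; rfl
  have hBB : ρ (sr 0) * ρ (sr 0) = 1 := by rw [← map_mul, sr_mul_self, map_one]
  have hcomm : ρ (r 1) * ρ (sr 0) = ρ (sr 0) * ρ (r 1) := by
    rw [← map_mul, ← map_mul, r_mul_sr, sr_mul_r]; rfl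
  have hmul : ρ (sr 1) = ρ (sr 0) * ρ (r 1) := by rw [← map_mul, sr_mul_r, zero_add]
  obtain ⟨a, b, hab⟩ := exists_eq_of_commute hA hcomm
  generalize ρ (r 1) = A at *
  generalize ρ (sr 0) = B at *
  subst hab
  rw [hmul] at hAB
  have hsq : (a • (1 : Matrix (Fin 2) (Fin 2) K) + b • A) * (a • 1 + b • A)
      = (a * a + b * b) • 1 + (2 * (a * b)) • A := by
    simp only [add_mul, mul_add, Matrix.smul_mul, Matrix.mul_smul, mul_one, one_mul, hAA,
      smul_smul]
    module
  rw [hsq, h2, zero_mul, zero_smul, add_zero] at hBB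
  have hone : a + b = 1 := by
    have h00 := congrFun (congrFun hBB 0) 0
    simp at h00
    have : (a + b - 1) ^ 2 = 0 := by linear_combination h00 + (a * b - a - b + 1) * h2
    linear_combination pow_eq_zero_iff two_ne_zero |>.1 this
  have hb0 : b ≠ 0 := by
    rintro rfl
    exact hB a (by simp)
  have hb1 : b ≠ 1 := by
    rintro rfl
    have : a = 0 := by linear_combination hone
    subst this
    exact hAB 1 (by simp [hAA])
  have ha : a = 1 + b := by linear_combination hone - b * h2
  classical
  have hcard : ({0, 1, b, a} : Finset K).card = 4 := by
    rw [Finset.card_insert_of_notMem, Finset.card_insert_of_notMem, Finset.card_pair]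
    · rw [ha]; intro h; apply one_ne_zero (α := K); linear_combination -h
    · simp only [Finset.mem_insert, Finset.mem_singleton, not_or]
      refine ⟨hb1.symm, fun h => hb0 ?_⟩
      linear_combination -h - ha
    · simp only [Finset.mem_insert, Finset.mem_singleton, not_or]
      refine ⟨zero_ne_one, hb0.symm, fun h => hb1 ?_⟩
      linear_combination -h - ha - h2
  have := Cardinal.mk_le_of_injective (Subtype.val_injective (p := (· ∈ ({0, 1, b, a} : Finset K))))
  rw [Cardinal.mk_fintype, Fintype.card_coe, hcard] at this
  exact_mod_cast this

/-- For odd `n` prime to the characteristic, a projectively faithful two-dimensional representation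
of `Dₙ` forces `ζₙ + ζₙ⁻¹` to be rational. -/
theorem exists_root_of_nonscalar (ρ : DihedralGroup n →* Matrix (Fin 2) (Fin 2) K)
    (hρ : ∀ g, g ≠ 1 → ∀ c : K, ρ g ≠ c • 1) (hn : Odd n) (hnK : (n : K) ≠ 0) :
    ∃ ζ : AlgebraicClosure K, IsPrimitiveRoot ζ n ∧
      ζ + ζ⁻¹ ∈ (algebraMap K (AlgebraicClosure K)).range := by
  set A := ρ (r 1) with hA
  have hAn : A ^ n = 1 := by rw [← map_pow, r_one_pow_n, map_one]
  have hB : ρ (sr 0) * ρ (sr 0) = 1 := by rw [← map_mul, sr_mul_self, map_one]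
  have hABA : A * ρ (sr 0) * A = ρ (sr 0) := by
    rw [← map_mul, ← map_mul, r_mul_sr, sr_mul_r]; simp
  have hBdet := congrArg Matrix.det hB
  have hABAdet := congrArg Matrix.det hABA
  have hAndet := congrArg Matrix.det hAn
  rw [Matrix.det_mul, Matrix.det_one] at hBdet
  rw [Matrix.det_mul, Matrix.det_mul] at hABAdet
  rw [Matrix.det_pow, Matrix.det_one] at hAndet
  have hdet2 : A.det ^ 2 = 1 := by
    linear_combination (ρ (sr 0)).det * hABAdet - (A.det ^ 2 - 1) * hBdet
  have hdet : A.det = 1 := by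
    obtain ⟨m, rfl⟩ := hn
    rwa [pow_succ, pow_mul, hdet2, one_pow, one_mul] at hAndet
  let f := algebraMap K (AlgebraicClosure K)
  obtain ⟨l, hl⟩ : ∃ l : AlgebraicClosure K, l ^ 2 - f A.trace * l + 1 = 0 := by
    open Polynomial in
    have := IsAlgClosed.exists_root (X ^ 2 - C (f A.trace) * X + 1 : (AlgebraicClosure K)[X])
      (by
        have : (X ^ 2 - C (f A.trace) * X + 1 : (AlgebraicClosure K)[X]).degree = 2 := by
          compute_degree!
        rw [this]; decide)
    obtain ⟨l, hl⟩ := this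
    exact ⟨l, by simpa using hl⟩
  have hl0 : l ≠ 0 := by rintro rfl; simp at hl
  have htr : f A.trace = l + l⁻¹ := by
    field_simp
    linear_combination -hl
  have ht' : (A.map f).trace = l + l⁻¹ := by
    rw [← htr, Matrix.trace_fin_two, Matrix.trace_fin_two, map_add]; rfl
  have hd' : (A.map f).det = l * l⁻¹ := by
    rw [mul_inv_cancel₀ hl0, ← RingHom.mapMatrix_apply, ← RingHom.map_det, hdet, map_one]
  have hmap : ∀ k, (A.map f) ^ k = (A ^ k).map f := fun k => by
    rw [← RingHom.mapMatrix_apply, ← map_pow, RingHom.mapMatrix_apply]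
  have hln : l ^ n = 1 := pow_eq_of_pow_eq_smul ht' hd' (by rw [hmap, hAn]; simp)
  have hn0 : 0 < n := hn.pos
  have key : ∀ k : ℕ, 0 < k → k < n → l ^ k ≠ 1 := by
    intro k hk hkn hlk
    suffices h : A ^ k = (1 : K) • 1 by
      rw [hA, ← map_pow, r_one_pow] at h
      exact hρ _ (r_ne_one_of_lt hk hkn) _ h
    rw [one_smul]
    rcases eq_or_ne l l⁻¹ with h | h
    · have hl1 : l = 1 := by
        have : l ^ 2 = 1 := by rw [sq]; nth_rewrite 2 [h]; exact mul_inv_cancel₀ hl0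
        obtain ⟨m, rfl⟩ := hn
        rwa [pow_succ, pow_mul, this, one_pow, one_mul] at hln
      have htr2 : A.trace = 2 := by
        apply f.injective
        rw [htr, hl1, map_ofNat]; norm_num
      have hN : (A - 1) * (A - 1) = 0 := by
        have := mat_sq A
        rw [htr2, hdet, one_smul] at this
        rw [sub_mul, mul_sub, this, two_smul, mul_one, one_mul]; abel
      have hpow : ∀ j : ℕ, A ^ j = 1 + (j : K) • (A - 1) := by
        intro j
        induction j with
        | zero => simp
        | succ j ih =>
          have e : A = 1 + (A - 1) := by abel
          rw [pow_succ, ih]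
          nth_rewrite 2 [e]
          rw [add_mul, mul_add, mul_add, Matrix.smul_mul, Matrix.smul_mul, hN]
          push_cast
          simp only [one_mul, mul_one, smul_zero]
          module
      have := hpow n
      rw [hAn, left_eq_add, smul_eq_zero] at this
      rcases this with h' | h'
      · exact absurd h' hnK
      · rw [sub_eq_zero.1 h', one_pow]
    · have := pow_eq_one_of_roots h ht' hd' hlk (by rw [inv_pow, hlk, inv_one])
      rw [hmap] at this
      apply Matrix.map_injective f.injective
      exact this.trans (by simp)
  refine ⟨l, ?_, A.trace, htr⟩
  exact IsPrimitiveRoot.mk_of_lt l hn0 hln key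

/-- The representation of `Dₙ` determined by matrices (or elements of any monoid) satisfying the
dihedral relations. -/
theorem exists_dihedral_hom {M : Type*} [Monoid M] [NeZero n] {A B : M} (hA : A ^ n = 1)
    (hB : B * B = 1) (hAB : A * B * A = B) :
    ∃ ρ : DihedralGroup n →* M, (∀ k : ℕ, ρ (r k) = A ^ k) ∧ ρ (sr 0) = B := by
  have hval : ∀ i j : ℕ, (i : ZMod n) = j → A ^ i = A ^ j := by
    intro i j h
    rw [ZMod.natCast_eq_natCast_iff'] at h
    rw [pow_eq_pow_mod i hA, pow_eq_pow_mod j hA, h]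
  have hadd : ∀ i j : ZMod n, A ^ (i + j).val = A ^ i.val * A ^ j.val := by
    intro i j
    rw [← pow_add]
    apply hval
    simp
  have hconj : ∀ k : ℕ, A ^ k * B * A ^ k = B := by
    intro k
    induction k with
    | zero => simp
    | succ k ih =>
      rw [pow_succ, mul_assoc, mul_assoc, ← pow_succ, pow_succ', ← mul_assoc B, ← mul_assoc A,
        ← mul_assoc A B, hAB, ← mul_assoc, ih]
  have hconj' : ∀ i j : ZMod n, A ^ i.val * B * A ^ j.val = B * A ^ (j - i).val := by
    intro i j
    have : A ^ j.val = A ^ i.val * A ^ (j - i).val := by rw [← hadd]; simp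
    rw [this, ← mul_assoc, hconj]
  refine ⟨MonoidHom.mk ⟨fun g => match g with
    | r i => A ^ i.val
    | sr i => B * A ^ i.val, ?_⟩ ?_, fun k => ?_, ?_⟩
  · change A ^ (0 : ZMod n).val = 1
    simp
  · rintro (i | i) (j | j)
    · rw [r_mul_r]
      exact hadd i j
    · rw [r_mul_sr]
      change B * A ^ (j - i).val = A ^ i.val * (B * A ^ j.val)
      rw [← mul_assoc, hconj']
    · rw [sr_mul_r]
      change B * A ^ (i + j).val = B * A ^ i.val * A ^ j.val
      rw [hadd, mul_assoc]
    · rw [sr_mul_sr]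
      change A ^ (j - i).val = B * A ^ i.val * (B * A ^ j.val)
      rw [mul_assoc B, ← mul_assoc _ B, hconj', ← mul_assoc, hB, one_mul]
  · exact hval _ _ (by simp)
  · change B * A ^ (0 : ZMod n).val = B
    simp

/-- For `n ≥ 3`, a representation of `Dₙ` without scalars among the nontrivial rotations has no
nontrivial scalars at all. -/
theorem nonscalar_of_rotations (hn : 3 ≤ n) (ρ : DihedralGroup n →* Matrix (Fin 2) (Fin 2) K)
    (hρ : ∀ k : ℕ, 0 < k → k < n → ∀ c : K, ρ (r 1) ^ k ≠ c • 1) :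
    ∀ g, g ≠ 1 → ∀ c : K, ρ g ≠ c • 1 := by
  have : NeZero n := ⟨by omega⟩
  rintro (i | i) hg c h
  · refine hρ i.val ?_ i.val_lt c ?_
    · refine Nat.pos_of_ne_zero fun h0 => hg ?_
      rw [(ZMod.val_eq_zero i).1 h0, r_zero]
    · rw [← map_pow, r_one_pow, ZMod.natCast_zmod_val, h]
  · have h1 : ρ (r 1) * ρ (sr i) = ρ (sr i) * ρ (r 1) := by
      rw [h]; simp
    have h2 : ρ (r 2) = 1 := by
      have e : (r 2 : DihedralGroup n) = sr i * (sr i * r 1 * (r 1)) := by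
        rw [sr_mul_r, sr_mul_r, sr_mul_sr]
        congr 1
        ring
      rw [e, map_mul, map_mul, map_mul, ← h1, ← map_mul ρ (r 1), r_mul_sr, ← map_mul, sr_mul_r,
        ← map_mul, sr_mul_sr]
      simp
    refine hρ 2 two_pos (by omega) 1 ?_
    rw [← map_pow, r_one_pow, one_smul, Nat.cast_ofNat, h2]

theorem exists_nonscalar_one : ∃ ρ : DihedralGroup 1 →* Matrix (Fin 2) (Fin 2) K,
    ∀ g, g ≠ 1 → ∀ c : K, ρ g ≠ c • 1 := by
  obtain ⟨ρ, -, h2⟩ := exists_dihedral_hom (n := 1) (A := (1 : Matrix (Fin 2) (Fin 2) K))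
    (B := !![0, 1; 1, 0]) (one_pow _) (by simp [Matrix.one_fin_two]) (by simp)
  refine ⟨ρ, ?_⟩
  rintro (i | i) hg c h
  · exact hg (by rw [Subsingleton.elim i 0, r_zero])
  · rw [Subsingleton.elim i 0, h2] at h
    simpa using congrFun (congrFun h 0) 1

theorem exists_nonscalar_of_root (hn : Odd n) {ζ : AlgebraicClosure K} (hζ : IsPrimitiveRoot ζ n)
    (hK : ζ + ζ⁻¹ ∈ (algebraMap K (AlgebraicClosure K)).range) :
    ∃ ρ : DihedralGroup n →* Matrix (Fin 2) (Fin 2) K, ∀ g, g ≠ 1 → ∀ c : K, ρ g ≠ c • 1 := by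
  rcases eq_or_ne n 1 with rfl | hn1
  · exact exists_nonscalar_one
  have hn3 : 3 ≤ n := by
    obtain ⟨m, rfl⟩ := hn
    omega
  have : NeZero n := ⟨by omega⟩
  obtain ⟨c, hc⟩ := hK
  have hζ0 : ζ ≠ 0 := hζ.ne_zero (by omega)
  have hne : ∀ k : ℕ, 0 < k → k < n → ζ ^ k ≠ (ζ⁻¹) ^ k := by
    intro k hk hkn h
    rw [inv_pow] at h
    replace h : ζ ^ (2 * k) = 1 := by
      rw [two_mul, pow_add]
      nth_rewrite 2 [h]
      exact mul_inv_cancel₀ (pow_ne_zero _ hζ0)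
    have := (Nat.coprime_two_right.2 hn).dvd_of_dvd_mul_left ((hζ.pow_eq_one_iff_dvd _).1 h)
    exact absurd (Nat.le_of_dvd hk this) (by omega)
  set A : Matrix (Fin 2) (Fin 2) K := !![0, -1; 1, c] with hA
  let f := algebraMap K (AlgebraicClosure K)
  have hmap : ∀ k, (A.map f) ^ k = (A ^ k).map f := fun k => by
    rw [← RingHom.mapMatrix_apply, ← map_pow, RingHom.mapMatrix_apply]
  have ht : (A.map f).trace = ζ + ζ⁻¹ := by
    rw [← hc, Matrix.trace_fin_two]; simp [hA, f]
  have hd : (A.map f).det = ζ * ζ⁻¹ := by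
    rw [mul_inv_cancel₀ hζ0, Matrix.det_fin_two]; simp [hA]
  have hAn : A ^ n = 1 := by
    have := pow_eq_one_of_roots (by simpa using hne 1 one_pos (by omega)) ht hd
      hζ.pow_eq_one (by rw [inv_pow, hζ.pow_eq_one, inv_one])
    rw [hmap] at this
    apply Matrix.map_injective f.injective
    exact this.trans (by simp)
  obtain ⟨ρ, h1, h2⟩ := exists_dihedral_hom (n := n) (A := A) (B := !![0, 1; 1, 0]) hAn
    (by simp [Matrix.one_fin_two]) (by simp [hA])
  refine ⟨ρ, nonscalar_of_rotations hn3 ρ fun k hk hkn c h => ?_⟩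
  have h1' : ρ (r 1) = A := by simpa using h1 1
  rw [h1'] at h
  have hm : (A.map f) ^ k = f c • 1 := by
    rw [hmap, h]
    ext i j
    fin_cases i <;> fin_cases j <;> simp
  refine hne k hk hkn ((pow_eq_of_pow_eq_smul ht hd hm).trans
    (pow_eq_of_pow_eq_smul (l := ζ⁻¹) (m := ζ) ?_ ?_ hm).symm)
  · rw [ht, add_comm]
  · rw [hd, mul_comm]

theorem exists_nonscalar_of_char {p : ℕ} [Fact p.Prime] [CharP K p] (hp : p ≠ 2) :
    ∃ ρ : DihedralGroup p →* Matrix (Fin 2) (Fin 2) K, ∀ g, g ≠ 1 → ∀ c : K, ρ g ≠ c • 1 := by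
  have hpp : p.Prime := Fact.out
  have hpow : ∀ k : ℕ, (!![1, 1; 0, 1] : Matrix (Fin 2) (Fin 2) K) ^ k = !![1, (k : K); 0, 1] := by
    intro k
    induction k with
    | zero => simp [Matrix.one_fin_two]
    | succ k ih => rw [pow_succ, ih]; simp [add_comm]
  obtain ⟨ρ, h1, h2⟩ := exists_dihedral_hom (n := p) (A := (!![1, 1; 0, 1] : Matrix _ _ K))
    (B := !![1, 0; 0, -1]) (by rw [hpow]; simp [Matrix.one_fin_two])
    (by simp [Matrix.one_fin_two]) (by simp)
  refine ⟨ρ, nonscalar_of_rotations ?_ ρ fun k hk hkn c h => ?_⟩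
  · have := hpp.two_le
    omega
  have h1' : ρ (r 1) = !![1, 1; 0, 1] := by simpa using h1 1
  rw [h1', hpow] at h
  have := congrFun (congrFun h 0) 1
  simp [CharP.cast_eq_zero_iff K p] at this
  exact Nat.not_dvd_of_pos_of_lt hk hkn this

theorem exists_nonscalar_two [CharP K 2] (hK : 4 ≤ Cardinal.mk K) :
    ∃ ρ : DihedralGroup 2 →* Matrix (Fin 2) (Fin 2) K, ∀ g, g ≠ 1 → ∀ c : K, ρ g ≠ c • 1 := by
  have h2 : (2 : K) = 0 := CharP.cast_eq_zero K 2
  obtain ⟨b, hb0, hb1⟩ : ∃ b : K, b ≠ 0 ∧ b ≠ 1 := by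
    by_contra! h
    classical
    have huniv : (Set.univ : Set K) ⊆ (({0, 1} : Finset K) : Set K) := fun x _ => by
      by_cases hx : x = 0
      · simp [hx]
      · simp [h x hx]
    have hle := Cardinal.mk_le_mk_of_subset huniv
    rw [Cardinal.mk_univ] at hle
    have h3 := (hK.trans (hle.trans_eq Cardinal.mk_coe_finset)).trans
      (Nat.cast_le.2 Finset.card_le_two)
    norm_cast at h3
  obtain ⟨ρ, h1, h2⟩ := exists_dihedral_hom (n := 2) (A := (!![1, 1; 0, 1] : Matrix _ _ K))
    (B := !![1, b; 0, 1]) (by rw [sq]; ext i j; fin_cases i <;> fin_cases j <;> simp [CharTwo.add_self_eq_zero])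
    (by ext i j; fin_cases i <;> fin_cases j <;> simp [CharTwo.add_self_eq_zero])
    (by simp [add_comm b, ← add_assoc, one_add_one_eq_two, h2])
  have h1' : ρ (r 1) = !![1, 1; 0, 1] := by simpa using h1 1
  have hZ : ∀ i : ZMod 2, i = 0 ∨ i = 1 := by decide
  refine ⟨ρ, ?_⟩
  rintro (i | i) hg c h
  · obtain rfl | rfl : i = 0 ∨ i = 1 := hZ i
    · exact hg r_zero
    · rw [h1'] at h
      simpa using congrFun (congrFun h 0) 1
  · obtain rfl | rfl : i = 0 ∨ i = 1 := hZ i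
    · rw [h2] at h
      exact hb0 (by simpa using congrFun (congrFun h 0) 1)
    · have e : (sr 1 : DihedralGroup 2) = sr 0 * r 1 := by rw [sr_mul_r, zero_add]
      rw [e, map_mul, h2, h1'] at h
      have := congrFun (congrFun h 0) 1
      simp at this
      apply hb1
      rw [← CharTwo.neg_eq b]
      linear_combination -this

end DihedralRepresentations

theorem trdeg_eq_algebra_trdeg (K L : Type*) [CommRing K] [CommRing L] [Algebra K L] :
    trdeg K L = Algebra.trdeg K L :=
  rfl

section GaloisAction

variable {K : Type*} [Field K] {G : Type*} [Group G]

theorem galAction_algebraMap (g : G) (p : MvPolynomial G K) :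
    galAction K G g (algebraMap _ (FnField K G) p) =
      algebraMap _ (FnField K G) (MvPolynomial.rename (g * ·) p) := by
  change IsFractionRing.fieldEquivOfAlgEquiv K (FnField K G) (FnField K G)
    (permHom K G (MulAction.toPermHom G G g)) _ = _
  rw [IsFractionRing.fieldEquivOfAlgEquiv_algebraMap]
  rfl

theorem mem_range_of_isAlgebraic_fnField {σ : Type*} {x : FnField K σ} (hx : IsAlgebraic K x) :
    ∃ c : K, x = algebraMap K (FnField K σ) c := by
  rcases eq_or_ne x 0 with rfl | hx0
  · exact ⟨0, by simp⟩
  have key : ∀ y : FnField K σ, IsAlgebraic K y →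
      ∃ p : MvPolynomial σ K, algebraMap _ (FnField K σ) p = y := fun y hy ↦
    IsIntegrallyClosed.isIntegral_iff.mp (hy.isIntegral.tower_top (A := MvPolynomial σ K))
  obtain ⟨p, rfl⟩ := key x hx
  obtain ⟨q, hq⟩ := key _ hx.inv
  have hpq : p * q = 1 := by
    apply FaithfulSMul.algebraMap_injective (MvPolynomial σ K) (FnField K σ)
    rw [map_mul, hq, map_one, mul_inv_cancel₀ hx0]
  obtain ⟨c, -, rfl⟩ := (MvPolynomial.isUnit_iff_eq_C_of_isReduced).mp (IsUnit.of_mul_eq_one q hpq)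
  exact ⟨c, by rw [IsScalarTower.algebraMap_apply K (MvPolynomial σ K)]; rfl⟩

theorem trdeg_ne_zero_of_faithful [Nontrivial G] {E : IntermediateField K (FnField K G)}
    (hE : ∀ g : G, g ≠ 1 → ∃ x ∈ E, galAction K G g x ≠ x) : trdeg K E ≠ 0 := by
  intro h
  obtain ⟨g, hg⟩ := exists_ne (1 : G)
  obtain ⟨x, hx, hgx⟩ := hE g hg
  rw [trdeg_eq_algebra_trdeg, _root_.trdeg_eq_zero_iff] at h
  have : IsAlgebraic K x := by
    simpa using (h.isAlgebraic ⟨x, hx⟩).algebraMap (A := FnField K G)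
  obtain ⟨c, rfl⟩ := mem_range_of_isAlgebraic_fnField this
  exact hgx (by simp)

theorem edK_eq_one_iff [Nontrivial G] : edK K G = 1 ↔
    ∃ E : IntermediateField K (FnField K G),
      (∀ g : G, ∀ x ∈ E, galAction K G g x ∈ E) ∧
      (∀ g : G, g ≠ 1 → ∃ x ∈ E, galAction K G g x ≠ x) ∧ trdeg K E = 1 := by
  constructor
  · intro h
    obtain ⟨E, h1, h2, h3⟩ := Nat.sInf_mem (Nat.nonempty_of_sInf_eq_succ h)
    refine ⟨E, h1, h2, h3.trans ?_⟩
    rw [← Nat.cast_one, ← h]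
    rfl
  · rintro ⟨E, h1, h2, h3⟩
    apply le_antisymm
    · exact Nat.sInf_le ⟨E, h1, h2, by simpa using h3⟩
    · rw [Nat.one_le_iff_ne_zero]
      intro h
      rcases Nat.sInf_eq_zero.mp h with ⟨E', -, h2', h3'⟩ | h'
      · exact trdeg_ne_zero_of_faithful h2' (by simpa using h3')
      · exact (Set.eq_empty_iff_forall_notMem.mp h') 1 ⟨E, h1, h2, by simpa using h3⟩

end GaloisAction

section OfRepresentation

open scoped Matrix

variable {K : Type*} [Field K] {G : Type*} [Group G]

theorem Matrix.exists_cyclic_row (A : Matrix (Fin 2) (Fin 2) K) (hA : ∀ c : K, A ≠ c • 1) :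
    ∃ w : Fin 2 → K, w 0 * (w ᵥ* A) 1 - w 1 * (w ᵥ* A) 0 ≠ 0 := by
  by_contra! h
  have h0 := h ![1, 0]
  have h1 := h ![0, 1]
  have h2 := h ![1, 1]
  simp [Matrix.vecMul, dotProduct, Fin.sum_univ_two] at h0 h1 h2
  apply hA (A 0 0)
  have h3 : A 1 1 = A 0 0 := by linear_combination h2 - h0 + h1
  ext i j
  fin_cases i <;> fin_cases j <;> simp [h0, h1, h3]

/-- A two-dimensional representation whose linear dual contains a cyclic vector embeds in the
space of linear forms. -/
theorem exists_linear_forms [Nontrivial G] [Finite G] (ρ : G →* Matrix (Fin 2) (Fin 2) K)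
    (hρ : ∀ g, g ≠ 1 → ∀ c : K, ρ g ≠ c • 1) :
    ∃ y : Fin 2 → FnField K G,
      (∀ g j, galAction K G g (y j) = ∑ i, y i * algebraMap K _ (ρ g i j)) ∧
      ∀ a b : K, y 0 * algebraMap K _ a + y 1 * algebraMap K _ b = 0 → a = 0 ∧ b = 0 := by
  classical
  have := Fintype.ofFinite G
  obtain ⟨g, hg⟩ := exists_ne (1 : G)
  obtain ⟨w, hw⟩ := Matrix.exists_cyclic_row (ρ g) (hρ g hg)
  let y : Fin 2 → MvPolynomial G K := fun j ↦
    ∑ h, MvPolynomial.X h * MvPolynomial.C ((w ᵥ* ρ h⁻¹) j)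
  refine ⟨fun j ↦ algebraMap _ _ (y j), fun g j ↦ ?_, fun a b hab ↦ ?_⟩
  · have : MvPolynomial.rename (g * ·) (y j) = ∑ i, y i * MvPolynomial.C (ρ g i j) := by
      simp only [y, map_sum, map_mul, MvPolynomial.rename_X, MvPolynomial.rename_C,
        Finset.sum_mul]
      rw [Finset.sum_comm, ← Equiv.sum_comp (Equiv.mulLeft g⁻¹)]
      refine Finset.sum_congr rfl fun h _ ↦ ?_
      simp only [Equiv.coe_mulLeft, mul_inv_cancel_left, mul_inv_rev, inv_inv, map_mul, mul_assoc,
        ← Finset.mul_sum, ← Matrix.vecMul_vecMul]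
      rw [Matrix.vecMul_eq_sum]
      simp [mul_comm]
    simp only [galAction_algebraMap, this, map_sum, map_mul]
    rfl
  · have h0 : y 0 * MvPolynomial.C a + y 1 * MvPolynomial.C b = 0 := by
      apply FaithfulSMul.algebraMap_injective (MvPolynomial G K) (FnField K G)
      rw [map_add, map_mul, map_mul, map_zero]
      exact hab
    have key : ∀ h : G, (w ᵥ* ρ h⁻¹) 0 * a + (w ᵥ* ρ h⁻¹) 1 * b = 0 := fun h ↦ by
      have := congrArg (MvPolynomial.eval (Pi.single h 1)) h0
      simpa [y, Pi.single_apply] using this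
    have k1 := key 1
    have k2 := key g⁻¹
    simp only [inv_one, map_one, Matrix.vecMul_one, inv_inv] at k1 k2
    constructor
    · apply (mul_eq_zero.mp (?_ : (w 0 * (w ᵥ* ρ g) 1 - w 1 * (w ᵥ* ρ g) 0) * a = 0)).resolve_left hw
      linear_combination (w ᵥ* ρ g) 1 * k1 - w 1 * k2
    · apply (mul_eq_zero.mp (?_ : (w 0 * (w ᵥ* ρ g) 1 - w 1 * (w ᵥ* ρ g) 0) * b = 0)).resolve_left hw
      linear_combination - (w ᵥ* ρ g) 0 * k1 + w 0 * k2

open IntermediateField in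
theorem edK_eq_one_of_nonscalar [Nontrivial G] [Finite G] (ρ : G →* Matrix (Fin 2) (Fin 2) K)
    (hρ : ∀ g, g ≠ 1 → ∀ c : K, ρ g ≠ c • 1) : edK K G = 1 := by
  obtain ⟨y, hy, hind⟩ := exists_linear_forms ρ hρ
  have hy1 : y 1 ≠ 0 := fun h ↦ one_ne_zero (hind 0 1 (by simp [h])).2
  have hy' : ∀ g j, galAction K G g (y j) =
      y 0 * algebraMap K _ (ρ g 0 j) + y 1 * algebraMap K _ (ρ g 1 j) := fun g j ↦ by
    rw [hy, Fin.sum_univ_two]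
  set t : FnField K G := y 0 / y 1 with ht
  have ht0 : y 0 = t * y 1 := by rw [ht, div_mul_cancel₀ _ hy1]
  have htc : ∀ c : K, t ≠ algebraMap K _ c := fun c hc ↦
    one_ne_zero (hind 1 (-c) (by rw [ht0, hc]; simp [mul_comm])).1
  have htr : Transcendental K t := fun h ↦
    let ⟨c, hc⟩ := mem_range_of_isAlgebraic_fnField h
    htc c hc
  have hgt : ∀ g, galAction K G g t =
      (t * algebraMap K _ (ρ g 0 0) + algebraMap K _ (ρ g 1 0)) /
        (t * algebraMap K _ (ρ g 0 1) + algebraMap K _ (ρ g 1 1)) := fun g ↦ by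
    rw [ht, map_div₀, hy', hy', ← ht, ht0]
    rw [← mul_div_mul_right (t * algebraMap K _ (ρ g 0 0) + algebraMap K _ (ρ g 1 0)) _ hy1]
    congr 1 <;> ring
  have hden : ∀ g, t * algebraMap K _ (ρ g 0 1) + algebraMap K _ (ρ g 1 1) ≠ 0 := fun g h ↦ by
    have : galAction K G g (y 1) = 0 := by
      rw [hy', ht0]
      linear_combination y 1 * h
    exact hy1 (by simpa using this)
  have htE : t ∈ K⟮t⟯ := mem_adjoin_simple_self K t
  refine edK_eq_one_iff.mpr ⟨K⟮t⟯, fun g x hx ↦ ?_, fun g hg ↦ ⟨t, htE, fun h ↦ ?_⟩, ?_⟩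
  · have : K⟮t⟯ ≤ K⟮t⟯.comap (galAction K G g : FnField K G →ₐ[K] FnField K G) := by
      rw [adjoin_simple_le_iff]
      change galAction K G g t ∈ K⟮t⟯
      rw [hgt]
      exact div_mem (add_mem (mul_mem htE (_root_.algebraMap_mem _ _)) (_root_.algebraMap_mem _ _))
        (add_mem (mul_mem htE (_root_.algebraMap_mem _ _)) (_root_.algebraMap_mem _ _))
    exact this hx
  · rw [hgt, div_eq_iff (hden g)] at h
    have hq : Polynomial.aeval t (Polynomial.C (ρ g 0 1) * Polynomial.X ^ 2 +
        Polynomial.C (ρ g 1 1 - ρ g 0 0) * Polynomial.X + Polynomial.C (- ρ g 1 0)) = 0 := by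
      simp only [map_add, map_mul, map_pow, Polynomial.aeval_C, Polynomial.aeval_X, map_sub,
        map_neg]
      linear_combination -h
    have hp := transcendental_iff.mp htr _ hq
    have h2 := congrArg (Polynomial.coeff · 2) hp
    have h1 := congrArg (Polynomial.coeff · 1) hp
    have h0 := congrArg (Polynomial.coeff · 0) hp
    simp [Polynomial.coeff_X, Polynomial.coeff_C] at h0 h1 h2
    apply hρ g hg (ρ g 0 0)
    ext i j
    fin_cases i <;> fin_cases j <;> simp [h0, h2, sub_eq_zero.mp h1]
  · rw [trdeg_eq_algebra_trdeg]
    apply le_antisymm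
    · have : Algebra.IsAlgebraic (Algebra.adjoin K {AdjoinSimple.gen K t}) K⟮t⟯ := by
        have htop : K⟮AdjoinSimple.gen K t⟯ = ⊤ := by
          apply IntermediateField.map_injective K⟮t⟯.val
          rw [adjoin_map, ← AlgHom.fieldRange_eq_map, fieldRange_val]
          simp
        rw [← isAlgebraic_adjoin_iff_top, htop, Algebra.isAlgebraic_iff_isIntegral]
        exact Algebra.isIntegral_of_surjective topEquiv.surjective
      exact (Algebra.IsAlgebraic.trdeg_le_cardinalMk K {AdjoinSimple.gen K t}).trans (by simp)
    · rw [Cardinal.one_le_iff_ne_zero, Ne, _root_.trdeg_eq_zero_iff]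
      intro h
      apply htr
      simpa using (h.isAlgebraic ⟨t, htE⟩).algebraMap (A := FnField K G)

end OfRepresentation

section Specialization

open MvPolynomial in
theorem exists_injOn_weight {σ : Type*} [Finite σ] (S : Finset (σ →₀ ℕ)) :
    ∃ w : σ → ℕ, Set.InjOn (fun s : σ →₀ ℕ ↦ ∑ᶠ i, s i * w i) S := by
  classical
  have := Fintype.ofFinite σ
  let P : MvPolynomial σ ℤ := ∏ q ∈ (S ×ˢ S).filter (fun q ↦ q.1 ≠ q.2),
    ∑ i, C ((q.1 i : ℤ) - q.2 i) * X i
  have hP : P ≠ 0 := by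
    refine Finset.prod_ne_zero_iff.mpr fun q hq h0 ↦ ?_
    apply (Finset.mem_filter.mp hq).2
    ext i
    have := congrArg (eval (Pi.single i 1)) h0
    simp [Pi.single_apply] at this
    lia
  by_contra! h
  apply hP
  refine funext_set (fun _ ↦ Set.range ((↑) : ℕ → ℤ))
    (fun _ ↦ Set.infinite_range_of_injective Nat.cast_injective) fun x hx ↦ ?_
  choose w hw using fun i ↦ hx i (Set.mem_univ i)
  obtain rfl : (fun i ↦ (w i : ℤ)) = x := _root_.funext hw
  have hw' := h w
  simp only [Set.InjOn, not_forall] at hw'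
  obtain ⟨s, hs, t, ht, hst, hne⟩ := hw'
  simp only [finsum_eq_sum_of_fintype] at hst
  rw [map_zero, map_prod]
  refine Finset.prod_eq_zero (i := (s, t))
    (Finset.mem_filter.mpr ⟨Finset.mem_product.mpr ⟨hs, ht⟩, hne⟩) ?_
  simp only [map_sum, map_mul, eval_C, eval_X, sub_mul, Finset.sum_sub_distrib]
  rw [sub_eq_zero]
  exact_mod_cast hst

open MvPolynomial in
/-- Substituting suitable powers of one variable detects all polynomials with given supports. -/
theorem exists_algHom_polynomial_ne_zero (K : Type*) [Field K] {σ : Type*} [Finite σ]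
    (S : Finset (σ →₀ ℕ)) :
    ∃ φ : MvPolynomial σ K →ₐ[K] Polynomial K, ∀ p, p.support ⊆ S → p ≠ 0 → φ p ≠ 0 := by
  classical
  have := Fintype.ofFinite σ
  obtain ⟨w, hw⟩ := exists_injOn_weight S
  refine ⟨aeval fun i ↦ Polynomial.X ^ w i, fun p hp hp0 h ↦ ?_⟩
  obtain ⟨s, hs⟩ := (support_nonempty (p := p)).mpr hp0
  apply mem_support_iff.mp hs
  have := congrArg (Polynomial.coeff · (∑ᶠ i, s i * w i)) h
  simp only [aeval_def, eval₂_eq', ← pow_mul, Finset.prod_pow_eq_pow_sum, Polynomial.finsetSum_coeff,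
    Polynomial.algebraMap_eq, Polynomial.coeff_C_mul, Polynomial.coeff_X_pow,
    Polynomial.coeff_zero, finsum_eq_sum_of_fintype] at this
  rw [Finset.sum_eq_single s] at this
  · simpa [mul_comm] using this
  · intro t ht hts
    rw [if_neg, mul_zero]
    intro he
    apply hts
    apply hw (hp ht) (hp hs)
    simpa [finsum_eq_sum_of_fintype, mul_comm] using he.symm
  · exact fun h ↦ (h hs).elim

end Specialization

section Place

open IntermediateField

/-- A specialization `R → K[X]` under which `f` stays nonconstant extends to every algebraic
extension of `K(f)` inside the fraction field of `R`. -/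
theorem exists_algHom_ratFunc_of_specialization {K R F : Type*} [Field K] [CommRing R] [IsDomain R]
    [IsIntegrallyClosed R] [Algebra K R] [Field F] [Algebra R F] [IsFractionRing R F] [Algebra K F]
    [IsScalarTower K R F] (φ : R →ₐ[K] Polynomial K) {a b : R} (hb : φ b ≠ 0)
    (hab : ∀ c : K, φ a ≠ Polynomial.C c * φ b) (E : IntermediateField K F)
    (hE : ∀ x ∈ E, IsAlgebraic K⟮algebraMap R F a / algebraMap R F b⟯ x) :
    Nonempty (E →ₐ[K] RatFunc K) := by
  set f : F := algebraMap R F a / algebraMap R F b with hf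
  let S : Submonoid R := (nonZeroDivisors (Polynomial K)).comap φ
  have hmem : ∀ s, s ∈ S ↔ φ s ≠ 0 := fun s ↦ by
    rw [Submonoid.mem_comap, mem_nonZeroDivisors_iff_ne_zero]
  have hS : S ≤ nonZeroDivisors R := fun s hs ↦ by
    rw [mem_nonZeroDivisors_iff_ne_zero]
    rintro rfl
    exact (hmem 0).mp hs (map_zero φ)
  let O := Localization.subalgebra.ofField F S hS
  have hOmem : ∀ x, x ∈ O ↔ ∃ (a s : R) (_ : s ∈ S), x = algebraMap R F a * (algebraMap R F s)⁻¹ :=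
    fun x ↦ Iff.rfl
  let Φ : R →+* RatFunc K := (algebraMap (Polynomial K) (RatFunc K)).comp (φ : R →+* Polynomial K)
  have hΦ0 : ∀ r, Φ r = 0 ↔ φ r = 0 := fun r ↦ by simp [Φ]
  have hΦ : ∀ s : S, IsUnit (Φ s) := fun s ↦ by
    rw [isUnit_iff_ne_zero, Ne, hΦ0]
    exact (hmem s).mp s.2
  let ψ : O →+* RatFunc K := IsLocalization.lift (M := S) hΦ
  have hψ : ∀ r, ψ (algebraMap R O r) = Φ r := IsLocalization.lift_eq hΦ
  have hψK : ∀ (c : K) (hc : algebraMap K F c ∈ O), ψ ⟨algebraMap K F c, hc⟩ = RatFunc.C c := by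
    intro c hc
    have : (⟨algebraMap K F c, hc⟩ : O) = algebraMap R O (algebraMap K R c) :=
      Subtype.ext (IsScalarTower.algebraMap_apply K R F c)
    rw [this, hψ]
    simp [Φ]
  have hinv : ∀ y : O, ψ y ≠ 0 → (y : F)⁻¹ ∈ O := by
    rintro ⟨y, hy⟩ h0
    obtain ⟨a, s, hs, rfl⟩ := (hOmem y).mp hy
    have ha : φ a ≠ 0 := by
      intro ha
      apply h0
      have hs0 : algebraMap R F s ≠ 0 := fun h ↦ (hmem s).mp hs (by
        rw [(FaithfulSMul.algebraMap_injective R F) (h.trans (map_zero _).symm), map_zero])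
      have : (⟨_, hy⟩ : O) * algebraMap R O s = algebraMap R O a :=
        Subtype.ext (inv_mul_cancel_right₀ hs0 (algebraMap R F a))
      have := congrArg ψ this
      rw [map_mul, hψ, hψ, (hΦ0 a).mpr ha] at this
      exact (mul_eq_zero.mp this).resolve_right (hΦ ⟨s, hs⟩).ne_zero
    exact (hOmem _).mpr ⟨s, a, (hmem a).mpr ha, by simp⟩
  have hfO : f ∈ O := (hOmem _).mpr ⟨a, b, (hmem b).mpr hb, div_eq_mul_inv _ _⟩
  have hb0 : algebraMap R F b ≠ 0 := fun h ↦ hb (by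
    rw [(FaithfulSMul.algebraMap_injective R F) (h.trans (map_zero _).symm), map_zero])
  have hψf : ψ ⟨f, hfO⟩ * Φ b = Φ a := by
    rw [← hψ, ← hψ, ← map_mul]
    congr 1
    exact Subtype.ext (div_mul_cancel₀ _ hb0)
  have htr : Transcendental K (ψ ⟨f, hfO⟩) := by
    apply RatFunc.transcendental_of_ne_C
    rintro ⟨c, hc⟩
    apply hab c
    apply RatFunc.algebraMap_injective K
    rw [map_mul, RatFunc.algebraMap_C, ← hc]
    exact hψf.symm
  let ψK : O.restrictScalars K →ₐ[K] RatFunc K := { ψ with commutes' := fun c ↦ hψK c _ }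
  have hpoly : ∀ P : Polynomial K, ∃ y : O, y = Polynomial.aeval f P ∧
      ψ y = Polynomial.aeval (ψ ⟨f, hfO⟩) P := fun P ↦
    let y : O.restrictScalars K := ⟨f, hfO⟩
    ⟨Polynomial.aeval y P, (Polynomial.aeval_algHom_apply (O.restrictScalars K).val y P).symm,
      (Polynomial.aeval_algHom_apply ψK y P).symm⟩
  have hfieldO : ∀ x ∈ K⟮f⟯, x ∈ O := by
    intro x hx
    obtain ⟨r, s, rfl⟩ := (mem_adjoin_simple_iff K x).mp hx
    rcases eq_or_ne s 0 with rfl | hs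
    · simp
    obtain ⟨y, hy, -⟩ := hpoly r
    obtain ⟨z, hz, hψz⟩ := hpoly s
    rw [div_eq_mul_inv, ← hy, ← hz]
    refine mul_mem y.2 (hinv z ?_)
    rw [hψz]
    exact fun h ↦ hs (transcendental_iff.mp htr s h)
  have : IsIntegrallyClosed O := isIntegrallyClosed_of_isLocalization O S hS
  have hEO : ∀ x ∈ E, x ∈ O := by
    intro x hx
    let ι : K⟮f⟯ →+* O := K⟮f⟯.toSubring.inclusion (T := O.toSubring) hfieldO
    have hint : IsIntegral O x := (hE x hx).isIntegral.map_of_comp_eq ι (RingHom.id F) rfl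
    obtain ⟨y, rfl⟩ := IsIntegrallyClosed.isIntegral_iff.mp hint
    exact y.2
  exact ⟨{ ψ.comp (E.toSubring.inclusion (T := O.toSubring) hEO) with
    commutes' := fun c ↦ hψK c _ }⟩

end Place

section Luroth

open IntermediateField

/-- Lüroth's theorem for subfields of transcendence degree one of a rational function field in
several variables. -/
theorem exists_ratFunc_algEquiv {K : Type*} [Field K] {σ : Type*} [Finite σ]
    (E : IntermediateField K (FnField K σ)) (hE : trdeg K E = 1) :
    Nonempty (RatFunc K ≃ₐ[K] E) := by
  classical
  have htr : Algebra.Transcendental K E := by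
    rw [← trdeg_ne_zero_iff, ← trdeg_eq_algebra_trdeg, hE]
    exact one_ne_zero
  obtain ⟨⟨f, hf⟩, hftr⟩ := htr.transcendental
  have hbasis : IsTranscendenceBasis K (fun _ : Unit ↦ (⟨f, hf⟩ : E)) := by
    apply AlgebraicIndependent.isTranscendenceBasis_of_lift_trdeg_le_of_finite
    · exact algebraicIndependent_unique_type_iff.mpr hftr
    · rw [← trdeg_eq_algebra_trdeg, hE]
      simp
  have halg : ∀ x ∈ E, IsAlgebraic K⟮f⟯ x := by
    intro x hx
    have h1 := (hbasis.isAlgebraic_field.isAlgebraic ⟨x, hx⟩).isIntegral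
    set L := adjoin K (Set.range fun _ : Unit ↦ (⟨f, hf⟩ : E)) with hL
    have hle : L.map E.val ≤ K⟮f⟯ := by
      rw [hL, adjoin_map, adjoin_le_iff]
      rintro _ ⟨_, ⟨_, rfl⟩, rfl⟩
      exact mem_adjoin_simple_self K f
    let ι : L →+* K⟮f⟯ := ((E.val.comp L.val : L →ₐ[K] FnField K σ) : L →+* FnField K σ).codRestrict
      K⟮f⟯.toSubring fun y ↦ hle ⟨y, y.2, rfl⟩
    exact (h1.map_of_comp_eq ι (E.val : E →+* FnField K σ) rfl).isAlgebraic
  obtain ⟨a, b, hb, rfl⟩ := IsFractionRing.div_surjective (MvPolynomial σ K) f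
  have hb0 : b ≠ 0 := nonZeroDivisors.ne_zero hb
  obtain ⟨φ, hφ⟩ := exists_algHom_polynomial_ne_zero K (a.support ∪ b.support)
  have hφa : ∀ c : K, φ a ≠ Polynomial.C c * φ b := by
    intro c hc
    have h0 : a - MvPolynomial.C c * b = 0 := by
      by_contra h
      refine hφ _ ?_ h ?_
      · refine (MvPolynomial.support_sub _ _ _).trans (Finset.union_subset_union_right ?_)
        rw [← MvPolynomial.smul_eq_C_mul]
        exact MvPolynomial.support_smul
      · rw [← MvPolynomial.smul_eq_C_mul, map_sub, map_smul, hc, Polynomial.smul_eq_C_mul, sub_self]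
    apply hftr
    have hc : algebraMap _ (FnField K σ) a / algebraMap _ _ b = algebraMap K _ c := by
      rw [div_eq_iff (by simpa using hb0), sub_eq_zero.mp h0, map_mul]
      rfl
    rw [← isAlgebraic_algebraMap_iff (FaithfulSMul.algebraMap_injective E (FnField K σ))]
    simpa [hc] using isAlgebraic_algebraMap c
  obtain ⟨j⟩ := exists_algHom_ratFunc_of_specialization φ
    (hφ b Finset.subset_union_right hb0) hφa E halg
  have hj : j.fieldRange ≠ ⊥ := by
    intro h
    have hmem : j ⟨_, hf⟩ ∈ j.fieldRange := ⟨_, rfl⟩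
    rw [h, mem_bot] at hmem
    obtain ⟨c, hc⟩ := hmem
    apply hftr
    rw [← isAlgebraic_algHom_iff j j.injective, ← hc]
    exact isAlgebraic_algebraMap c
  exact ⟨(RatFunc.Luroth.algEquiv hj).trans (AlgEquiv.ofInjectiveField j).symm⟩

end Luroth

section Moebius

open IntermediateField

/-- Automorphisms of `K(X)` are fractional linear. -/
theorem RatFunc.exists_algEquiv_X_mul_eq {K : Type*} [Field K] (α : RatFunc K ≃ₐ[K] RatFunc K) :
    ∃ a b c d : K, RatFunc.C c * RatFunc.X + RatFunc.C d ≠ 0 ∧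
      α RatFunc.X * (RatFunc.C c * RatFunc.X + RatFunc.C d) =
        RatFunc.C a * RatFunc.X + RatFunc.C b := by
  set f := α RatFunc.X with hf
  have htop : K⟮f⟯ = ⊤ := by
    have h := congrArg (IntermediateField.map (α : RatFunc K →ₐ[K] RatFunc K))
      (RatFunc.adjoin_X (K := K))
    rw [adjoin_map, ← AlgHom.fieldRange_eq_map] at h
    simpa using h.trans (AlgHom.fieldRange_eq_top.mpr α.surjective)
  have hdeg := RatFunc.finrank_eq_max_natDegree f
  rw [htop, IntermediateField.finrank_top] at hdeg
  have hlin : ∀ p : Polynomial K, p.natDegree ≤ 1 →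
      algebraMap _ (RatFunc K) p = RatFunc.C (p.coeff 1) * RatFunc.X + RatFunc.C (p.coeff 0) :=
    fun p hp ↦ by
      conv_lhs => rw [Polynomial.eq_X_add_C_of_natDegree_le_one hp]
      simp
  refine ⟨f.num.coeff 1, f.num.coeff 0, f.denom.coeff 1, f.denom.coeff 0, ?_, ?_⟩
  · rw [← hlin _ (by lia)]
    simpa using f.denom_ne_zero
  · rw [← hlin _ (by lia), ← hlin _ (by lia), ← eq_div_iff (by simpa using f.denom_ne_zero),
      RatFunc.num_div_denom]

/-- Two `K`-algebra homomorphisms out of `K(X)` agreeing on `X` are equal. -/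
theorem RatFunc.algHom_ext_X {K L : Type*} [Field K] [Field L] [Algebra K L]
    {φ ψ : RatFunc K →ₐ[K] L} (h : φ RatFunc.X = ψ RatFunc.X) : φ = ψ := by
  have key : ∀ p : Polynomial K, φ (algebraMap _ _ p) = ψ (algebraMap _ _ p) := fun p ↦ by
    have : φ.comp (IsScalarTower.toAlgHom K (Polynomial K) (RatFunc K)) =
        ψ.comp (IsScalarTower.toAlgHom K (Polynomial K) (RatFunc K)) := by
      ext
      simpa using h
    exact DFunLike.congr_fun this p
  ext x
  rw [← RatFunc.num_div_denom x, map_div₀, map_div₀, key, key]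

end Moebius

section ToRepresentation

open MvPolynomial in
theorem exists_linear_of_moebius {K σ : Type*} [Field K] (e : Equiv.Perm σ)
    {f h : MvPolynomial σ K} (hrel : IsRelPrime f h) (hf : f ≠ 0) {a b c d : K}
    (hcd : C c * f + C d * h ≠ 0)
    (H : rename e f * (C c * f + C d * h) = rename e h * (C a * f + C b * h)) :
    ∃ p q r u : K, rename e f = C p * f + C r * h ∧ rename e h = C q * f + C u * h := by
  have hinj := rename_injective (R := K) e e.injective
  have hsf : rename e f ≠ 0 := by rwa [Ne, map_eq_zero_iff _ hinj]
  have hrel' : IsRelPrime (rename e f) (rename e h) := by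
    intro x hx hy
    have hx' := map_dvd (renameEquiv K e.symm) hx
    have hy' := map_dvd (renameEquiv K e.symm) hy
    simp only [renameEquiv_apply, rename_rename, Equiv.symm_comp_self, rename_id_apply] at hx' hy'
    exact (isUnit_map_iff (renameEquiv K e.symm) x).mp (hrel hx' hy')
  obtain ⟨w, hw⟩ := hrel'.dvd_of_dvd_mul_left (Dvd.intro _ H)
  have hw' : C c * f + C d * h = rename e h * w := by
    apply mul_left_cancel₀ hsf
    rw [H, hw]
    ring
  have hw0 : w ≠ 0 := by
    rintro rfl
    exact hcd (by rw [hw', mul_zero])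
  have hdeg : ∀ p q : K, (C p * f + C q * h).totalDegree ≤ max f.totalDegree h.totalDegree :=
    fun p q ↦ (totalDegree_add _ _).trans <| max_le_max
      (by rw [← smul_eq_C_mul]; exact totalDegree_smul_le _ _)
      (by rw [← smul_eq_C_mul]; exact totalDegree_smul_le _ _)
  have hren : ∀ p : MvPolynomial σ K, (rename e p).totalDegree = p.totalDegree :=
    fun p ↦ totalDegree_renameEquiv e p
  have h1 := hdeg a b
  have h2 := hdeg c d
  have hsh : rename e h ≠ 0 := fun h0 ↦ hcd (by rw [hw', h0, zero_mul])
  rw [hw, totalDegree_mul_of_isDomain hsf hw0, hren] at h1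
  rw [hw', totalDegree_mul_of_isDomain hsh hw0, hren] at h2
  have hdw : w.totalDegree = 0 := by lia
  obtain ⟨v, rfl⟩ : ∃ v, w = C v := ⟨_, totalDegree_eq_zero_iff_eq_C.mp hdw⟩
  have hv : v ≠ 0 := by
    rintro rfl
    exact hw0 (map_zero C)
  have hvv : (C v : MvPolynomial σ K) * C v⁻¹ = 1 := by rw [← C_mul, mul_inv_cancel₀ hv, C_1]
  refine ⟨v⁻¹ * a, v⁻¹ * c, v⁻¹ * b, v⁻¹ * d, ?_, ?_⟩
  · simp only [C_mul]
    linear_combination -C v⁻¹ * hw - rename e f * hvv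
  · simp only [C_mul]
    linear_combination -C v⁻¹ * hw' - rename e h * hvv

variable {K : Type*} [Field K] {G : Type*} [Group G]

open MvPolynomial in
theorem exists_moebius_generator [Finite G] (E : IntermediateField K (FnField K G))
    (hstab : ∀ g : G, ∀ x ∈ E, galAction K G g x ∈ E)
    (hfaith : ∀ g : G, g ≠ 1 → ∃ x ∈ E, galAction K G g x ≠ x) (hE : trdeg K E = 1) :
    ∃ t : FnField K G, (∀ c : K, t ≠ algebraMap K _ c) ∧
      (∀ g : G, g ≠ 1 → galAction K G g t ≠ t) ∧
      ∀ g : G, ∃ a b c d : K, algebraMap K _ c * t + algebraMap K _ d ≠ 0 ∧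
        galAction K G g t * (algebraMap K _ c * t + algebraMap K _ d) =
          algebraMap K _ a * t + algebraMap K _ b := by
  obtain ⟨Θ⟩ := exists_ratFunc_algEquiv E hE
  let τ : RatFunc K →ₐ[K] FnField K G := E.val.comp Θ
  have hτC : ∀ c, τ (RatFunc.C c) = algebraMap K _ c := fun c ↦ τ.commutes c
  refine ⟨τ RatFunc.X, fun c hc ↦ ?_, fun g hg h ↦ ?_, fun g ↦ ?_⟩
  · rw [← hτC] at hc
    have := congrArg RatFunc.num (τ.injective hc)
    rw [RatFunc.num_X, RatFunc.num_C] at this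
    exact Polynomial.X_ne_C c this
  · obtain ⟨x, hx, hgx⟩ := hfaith g hg
    have heq : (galAction K G g : FnField K G →ₐ[K] FnField K G).comp τ = τ :=
      RatFunc.algHom_ext_X h
    have := DFunLike.congr_fun heq (Θ.symm ⟨x, hx⟩)
    apply hgx
    simpa [τ] using this
  · let γ : G → E →ₐ[K] E := fun g ↦
      ((galAction K G g : FnField K G →ₐ[K] FnField K G).comp E.val).codRestrict E.toSubalgebra
        fun x ↦ hstab g x x.2
    have hγv : ∀ g x, (γ g x : FnField K G) = galAction K G g x := fun _ _ ↦ rfl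
    have hγ : ∀ g k, (γ g).comp (γ k) = γ (g * k) := fun g k ↦ AlgHom.ext fun x ↦ Subtype.ext <| by
      rw [AlgHom.comp_apply, hγv, hγv, hγv, map_mul, AlgEquiv.mul_apply]
    have hγ1 : γ 1 = AlgHom.id K E := AlgHom.ext fun x ↦ Subtype.ext <| by
      rw [hγv, map_one, AlgEquiv.one_apply, AlgHom.id_apply]
    let γe : E ≃ₐ[K] E := AlgEquiv.ofAlgHom (γ g) (γ g⁻¹)
      (by rw [hγ, mul_inv_cancel, hγ1]) (by rw [hγ, inv_mul_cancel, hγ1])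
    obtain ⟨a, b, c, d, h0, h⟩ :=
      RatFunc.exists_algEquiv_X_mul_eq ((Θ.trans γe).trans Θ.symm)
    refine ⟨a, b, c, d, ?_, ?_⟩
    · rw [← hτC, ← hτC, ← map_mul, ← map_add, Ne, map_eq_zero]
      exact h0
    · have h' := congrArg τ h
      simp only [map_mul, map_add, hτC] at h'
      rw [← h']
      congr 1
      simp [τ, γe, hγv]

open MvPolynomial in
theorem exists_nonscalar_of_edK_eq_one [Nontrivial G] [Finite G] (h1 : edK K G = 1) :
    ∃ ρ : G →* Matrix (Fin 2) (Fin 2) K, ∀ g, g ≠ 1 → ∀ c : K, ρ g ≠ c • 1 := by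
  obtain ⟨E, hstab, hfaith, hE⟩ := edK_eq_one_iff.mp h1
  obtain ⟨t, htc, htg, htm⟩ := exists_moebius_generator E hstab hfaith hE
  set f := IsFractionRing.num (MvPolynomial G K) t
  set h := (IsFractionRing.den (MvPolynomial G K) t).1
  let A := algebraMap (MvPolynomial G K) (FnField K G)
  have hA : Function.Injective A := FaithfulSMul.algebraMap_injective _ _
  have hAC : ∀ c, A (C c) = algebraMap K _ c := fun _ ↦ rfl
  have hrel : IsRelPrime f h := IsFractionRing.num_den_reduced _ t
  have ht : t = A f / A h := (IsFractionRing.mk'_num_den' _ t).symm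
  have hh0 : h ≠ 0 := nonZeroDivisors.ne_zero (IsFractionRing.den (MvPolynomial G K) t).2
  have hAh : A h ≠ 0 := (map_ne_zero_iff A hA).mpr hh0
  have hf0 : f ≠ 0 := fun h0 ↦ htc 0 (by rw [ht, h0]; simp)
  have hind : ∀ x y x' y' : K, C x * f + C y * h = C x' * f + C y' * h → x = x' ∧ y = y' := by
    intro x y x' y' hxy
    have hx : x = x' := by
      by_contra hne
      have hsub := sub_ne_zero.mpr hne
      apply htc ((y' - y) / (x - x'))
      rw [ht, div_eq_iff hAh, map_div₀, div_mul_eq_mul_div,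
        eq_div_iff ((map_ne_zero_iff _ (algebraMap K _).injective).mpr hsub), ← hAC, ← hAC,
        ← map_mul, ← map_mul]
      congr 1
      simp only [C_sub]
      linear_combination hxy
    refine ⟨hx, ?_⟩
    subst hx
    exact C_injective _ _ (mul_right_cancel₀ hh0 (add_left_cancel hxy))
  have hlin : ∀ g : G, ∃ p q r u : K, rename (g * ·) f = C p * f + C r * h ∧
      rename (g * ·) h = C q * f + C u * h := fun g ↦ by
    obtain ⟨a, b, c, d, h0, H⟩ := htm g
    have hAsh : A (rename (g * ·) h) ≠ 0 := by
      rw [← galAction_algebraMap]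
      exact (map_ne_zero_iff _ (galAction K G g).injective).mpr hAh
    have hA2 : ∀ x y : K, A (C x * f + C y * h) =
        A h * (algebraMap K _ x * t + algebraMap K _ y) := fun x y ↦ by
      rw [map_add, map_mul, map_mul, hAC, hAC, ht]
      field_simp
    refine exists_linear_of_moebius (Equiv.mulLeft g) hrel hf0 (a := a) (b := b) (c := c) (d := d)
      ?_ (hA ?_)
    · rw [← map_ne_zero_iff A hA, hA2]
      exact mul_ne_zero hAh h0
    · rw [map_mul, map_mul, hA2, hA2, ← H]
      change A (rename (g * ·) f) * _ = A (rename (g * ·) h) * _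
      rw [ht, map_div₀, galAction_algebraMap, galAction_algebraMap]
      change _ = _ * (_ * (A (rename (g * ·) f) / A (rename (g * ·) h) * _))
      field_simp
  choose p q r u hf hh using hlin
  have hmul : ∀ g k (x : MvPolynomial G K),
      rename (g * ·) (rename (k * ·) x) = rename (g * k * ·) x := fun g k x ↦ by
    rw [rename_rename]
    congr 2
    ext
    simp [mul_assoc]
  have hmulf : ∀ g k, p (g * k) = p g * p k + q g * r k ∧ r (g * k) = r g * p k + u g * r k :=
    fun g k ↦ hind _ _ _ _ <| by
      rw [← hf, ← hmul, hf k, map_add, map_mul, map_mul, rename_C, rename_C, hf, hh]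
      simp only [C_add, C_mul]
      ring
  have hmulh : ∀ g k, q (g * k) = p g * q k + q g * u k ∧ u (g * k) = r g * q k + u g * u k :=
    fun g k ↦ hind _ _ _ _ <| by
      rw [← hh, ← hmul, hh k, map_add, map_mul, map_mul, rename_C, rename_C, hf, hh]
      simp only [C_add, C_mul]
      ring
  have hone : ∀ x : MvPolynomial G K, rename ((1 : G) * ·) x = x := fun x ↦ by
    simp [Function.id_def.symm]
  have hf1 : p 1 = 1 ∧ r 1 = 0 := hind _ _ _ _ (by rw [← hf, hone]; simp)
  have hh1 : q 1 = 0 ∧ u 1 = 1 := hind _ _ _ _ (by rw [← hh, hone]; simp)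
  refine ⟨{
    toFun := fun g ↦ !![p g, q g; r g, u g]
    map_one' := by rw [hf1.1, hf1.2, hh1.1, hh1.2, Matrix.one_fin_two]
    map_mul' := fun g k ↦ by
      rw [(hmulf g k).1, (hmulf g k).2, (hmulh g k).1, (hmulh g k).2, Matrix.mul_fin_two] },
    fun g hg c hc ↦ htg g hg ?_⟩
  have hc' : !![p g, q g; r g, u g] = c • (1 : Matrix (Fin 2) (Fin 2) K) := hc
  have h00 : p g = c := by simpa using congrFun (congrFun hc' 0) 0
  have h01 : q g = 0 := by simpa using congrFun (congrFun hc' 0) 1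
  have h10 : r g = 0 := by simpa using congrFun (congrFun hc' 1) 0
  have h11 : u g = c := by simpa using congrFun (congrFun hc' 1) 1
  have hsf : galAction K G g (A f) = A (C c) * A f := by
    rw [galAction_algebraMap, hf, h00, h10, C_0, zero_mul, add_zero, map_mul]
  have hsh : galAction K G g (A h) = A (C c) * A h := by
    rw [galAction_algebraMap, hh, h11, h01, C_0, zero_mul, zero_add, map_mul]
  have hc0 : A (C c) ≠ 0 := fun h0 ↦ hAh <| by
    rw [h0, zero_mul] at hsh
    exact (map_eq_zero_iff _ (galAction K G g).injective).mp hsh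
  rw [ht, map_div₀, hsf, hsh, mul_div_mul_left _ _ hc0]

end ToRepresentation

/-- Necessary and sufficient conditions for the dihedral group `Dₙ` of order `2n` to
have essential dimension `1` over a field `K`.
(1) If `char K ≠ 2`: `ed_K(Dₙ) = 1` iff `n` is odd, and moreover `ζₙ + ζₙ⁻¹ ∈ K` (for
some primitive `n`-th root of unity `ζₙ` in an algebraic closure of `K`) in case
`char K ∤ n`, while `n = char K` in case `char K = p > 0` divides `n`.
(2) If `char K = 2`: `ed_K(Dₙ) = 1` iff either `n` is odd and `ζₙ + ζₙ⁻¹ ∈ K`, or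
`n = 2` and `K` has at least four elements. -/
theorem edK_dihedralGroup_eq_one_iff (K : Type*) [Field K] (n : ℕ) (hn : 1 ≤ n) :
    (ringChar K ≠ 2 →
      (edK K (DihedralGroup n) = 1 ↔
        (Odd n ∧
          (¬ ringChar K ∣ n →
            ∃ ζ : AlgebraicClosure K, IsPrimitiveRoot ζ n ∧
              ζ + ζ⁻¹ ∈ (algebraMap K (AlgebraicClosure K)).range) ∧
          (ringChar K ≠ 0 → ringChar K ∣ n → n = ringChar K)))) ∧
    (ringChar K = 2 →
      (edK K (DihedralGroup n) = 1 ↔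
        ((Odd n ∧
            ∃ ζ : AlgebraicClosure K, IsPrimitiveRoot ζ n ∧
              ζ + ζ⁻¹ ∈ (algebraMap K (AlgebraicClosure K)).range) ∨
          (n = 2 ∧ 4 ≤ Cardinal.mk K)))) := by
  have : NeZero n := ⟨by lia⟩
  have hiff : edK K (DihedralGroup n) = 1 ↔
      ∃ ρ : DihedralGroup n →* Matrix (Fin 2) (Fin 2) K, ∀ g, g ≠ 1 → ∀ c : K, ρ g ≠ c • 1 :=
    ⟨exists_nonscalar_of_edK_eq_one, fun ⟨ρ, hρ⟩ ↦ edK_eq_one_of_nonscalar ρ hρ⟩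
  have hcast : (n : K) = 0 ↔ ringChar K ∣ n := ringChar.spec K n
  have hprime : ringChar K ≠ 0 → Fact (ringChar K).Prime := fun h ↦
    ⟨(CharP.char_is_prime_or_zero K (ringChar K)).resolve_right h⟩
  have hchar : CharP K (ringChar K) := ringChar.charP K
  rw [hiff]
  refine ⟨fun h2 ↦ ⟨?_, ?_⟩, fun h2 ↦ ⟨?_, ?_⟩⟩
  · rintro ⟨ρ, hρ⟩
    have h2' : (2 : K) ≠ 0 := Ring.two_ne_zero h2
    refine ⟨odd_of_nonscalar ρ hρ hn h2', fun hdvd ↦ ?_, fun h0 hdvd ↦ ?_⟩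
    · exact exists_root_of_nonscalar ρ hρ (odd_of_nonscalar ρ hρ hn h2') (hcast.not.mpr hdvd)
    · have := hprime h0
      exact eq_char_of_nonscalar ρ hρ hn hdvd
  · rintro ⟨hodd, hroot, hp⟩
    by_cases hdvd : ringChar K ∣ n
    · have h0 : ringChar K ≠ 0 := fun h0 ↦ by
        rw [h0, zero_dvd_iff] at hdvd
        lia
      have := hprime h0
      have hex := exists_nonscalar_of_char (K := K) (p := ringChar K) h2
      rwa [← hp h0 hdvd] at hex
    · obtain ⟨ζ, hζ, hζK⟩ := hroot hdvd
      exact exists_nonscalar_of_root hodd hζ hζK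
  · rintro ⟨ρ, hρ⟩
    have : CharP K 2 := h2 ▸ hchar
    have : Fact (Nat.Prime 2) := ⟨Nat.prime_two⟩
    rcases Nat.even_or_odd n with heven | hodd
    · obtain rfl := eq_char_of_nonscalar (p := 2) ρ hρ hn heven.two_dvd
      exact Or.inr ⟨rfl, four_le_card_of_nonscalar ρ hρ⟩
    · refine Or.inl ⟨hodd, exists_root_of_nonscalar ρ hρ hodd ?_⟩
      rw [Ne, hcast, h2]
      exact hodd.not_two_dvd_nat
  · have : CharP K 2 := h2 ▸ hchar
    rintro (⟨hodd, ζ, hζ, hζK⟩ | ⟨rfl, hK⟩)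
    · exact exists_nonscalar_of_root hodd hζ hζK
    · exact exists_nonscalar_two hK
end
end
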